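/- arXiv:1309.4624 — 8 statements merged into one kernel-verified Lean document; each statement's English description precedes it below -/
import Mathlib

section
/- Under the stated assumptions, for every y in U = [-1/2,1/2]^ℕ the parametric bilinear form a(y;·,·) satisfies both uniform inf-sup conditions with constant μ = (1 - κ/2)·μ₀; that is, inf_{0≠v∈X} sup_{0≠w∈Y} a(y;v,w)/(‖v‖_X ‖w‖_Y) ≥ (1-κ/2)μ₀ and inf_{0≠w∈Y} sup_{0≠v∈X} a(y;v,w)/(‖v‖_X ‖w‖_Y) ≥ (1-κ/2)μ₀. -/
theorem iSup_div_norm_mul_norm {E G : Type*} [NormedAddCommGroup E] [NormedSpace ℝ E]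
    [NormedAddCommGroup G] [NormedSpace ℝ G] [Nontrivial G]
    (F : E →L[ℝ] G →L[ℝ] ℝ) (v : E) :
    (⨆ w : {w : G // w ≠ 0}, F v w.1 / (‖v‖ * ‖w.1‖)) = ‖F v‖ / ‖v‖ := by
  obtain ⟨w₀, hw₀⟩ := exists_ne (0 : G)
  have : Nonempty {w : G // w ≠ 0} := ⟨⟨w₀, hw₀⟩⟩
  have hle : ∀ w : {w : G // w ≠ 0}, F v w.1 / ‖w.1‖ ≤ ‖F v‖ := fun w =>
    (div_le_iff₀ (norm_pos_iff.2 w.2)).2 ((le_abs_self _).trans ((F v).le_opNorm w.1))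
  have hbdd : BddAbove (Set.range fun w : {w : G // w ≠ 0} => F v w.1 / ‖w.1‖) :=
    ⟨‖F v‖, by rintro _ ⟨w, rfl⟩; exact hle w⟩
  have hnorm : (⨆ w : {w : G // w ≠ 0}, F v w.1 / ‖w.1‖) = ‖F v‖ := by
    refine le_antisymm (ciSup_le hle) ?_
    have habs : ∀ w : {w : G // w ≠ 0},
        |F v w.1| ≤ (⨆ w : {w : G // w ≠ 0}, F v w.1 / ‖w.1‖) * ‖w.1‖ := by
      intro w
      have hpos := norm_pos_iff.2 w.2
      refine abs_le'.2 ⟨(div_le_iff₀ hpos).1 (le_ciSup hbdd w), ?_⟩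
      have h := le_ciSup hbdd ⟨-w.1, neg_ne_zero.2 w.2⟩
      simp only [map_neg, norm_neg] at h
      exact (div_le_iff₀ hpos).1 h
    refine (F v).opNorm_le_bound ?_ fun w => ?_
    · exact nonneg_of_mul_nonneg_left ((abs_nonneg _).trans (habs ⟨w₀, hw₀⟩))
        (norm_pos_iff.2 hw₀)
    · by_cases hw : w = 0
      · simp [hw]
      · exact habs ⟨w, hw⟩
  rw [← hnorm, div_eq_mul_inv, Real.iSup_mul_of_nonneg (by positivity)]
  refine iSup_congr fun w => ?_
  rw [mul_comm ‖v‖, ← div_div, div_eq_mul_inv _ ‖v‖]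

theorem le_iInf_iSup_div_norm_iff {E G : Type*} [NormedAddCommGroup E] [NormedSpace ℝ E]
    [NormedAddCommGroup G] [NormedSpace ℝ G] [Nontrivial E] [Nontrivial G]
    (F : E →L[ℝ] G →L[ℝ] ℝ) (c : ℝ) :
    c ≤ (⨅ v : {v : E // v ≠ 0}, ⨆ w : {w : G // w ≠ 0}, F v.1 w.1 / (‖v.1‖ * ‖w.1‖)) ↔
      ∀ v : E, c * ‖v‖ ≤ ‖F v‖ := by
  obtain ⟨v₀, hv₀⟩ := exists_ne (0 : E)
  have : Nonempty {v : E // v ≠ 0} := ⟨⟨v₀, hv₀⟩⟩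
  simp only [iSup_div_norm_mul_norm]
  have hbdd : BddBelow (Set.range fun v : {v : E // v ≠ 0} => ‖F v.1‖ / ‖v.1‖) :=
    ⟨0, by rintro _ ⟨v, rfl⟩; positivity⟩
  rw [le_ciInf_iff hbdd]
  refine ⟨fun h v => ?_, fun h v => (le_div_iff₀ (norm_pos_iff.2 v.2)).2 (h v.1)⟩
  by_cases hv : v = 0
  · simp [hv]
  · exact (le_div_iff₀ (norm_pos_iff.2 hv)).1 (h ⟨v, hv⟩)

theorem nontrivial_of_iInf_pos {E : Type*} [Zero E] {f : {v : E // v ≠ 0} → ℝ}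
    (h : 0 < ⨅ v, f v) : Nontrivial E := by
  by_contra hE
  rw [not_nontrivial_iff_subsingleton] at hE
  have : IsEmpty {v : E // v ≠ 0} := ⟨fun v => v.2 (Subsingleton.elim _ _)⟩
  rw [Real.iInf_of_isEmpty] at h
  exact h.false

/-- **Uniform inf-sup conditions for the parametric bilinear form.**
`X`, `Y` are separable reflexive Banach spaces, `A₀ : X →L Y'` with two-sided
inverse `T`, fluctuation operators `A j`, `β j = ‖A₀⁻¹ A j‖`, `∑ β j ≤ κ < 2`.
For every `y ∈ U = [-1/2,1/2]^ℕ` the parametric bilinear form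
`a(y; v, w) = ⟨w, (A₀ + ∑ yⱼ Aⱼ) v⟩` satisfies both inf-sup conditions with
constant `(1 - κ/2) * μ₀`. -/
theorem parametric_inf_sup
    {X Y : Type*} [NormedAddCommGroup X] [NormedSpace ℝ X] [CompleteSpace X]
    [TopologicalSpace.SeparableSpace X]
    [NormedAddCommGroup Y] [NormedSpace ℝ Y] [CompleteSpace Y]
    [TopologicalSpace.SeparableSpace Y]
    (A₀ : X →L[ℝ] Y →L[ℝ] ℝ) (A : ℕ → X →L[ℝ] Y →L[ℝ] ℝ)
    (T : (Y →L[ℝ] ℝ) →L[ℝ] X)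
    (hT₁ : ∀ v : X, T (A₀ v) = v) (hT₂ : ∀ g : Y →L[ℝ] ℝ, A₀ (T g) = g)
    (μ₀ : ℝ) (hμ₀ : 0 < μ₀)
    (hinfsup₁ : (⨅ v : {v : X // v ≠ 0}, ⨆ w : {w : Y // w ≠ 0},
        A₀ v.1 w.1 / (‖v.1‖ * ‖w.1‖)) ≥ μ₀)
    (hinfsup₂ : (⨅ w : {w : Y // w ≠ 0}, ⨆ v : {v : X // v ≠ 0},
        A₀ v.1 w.1 / (‖v.1‖ * ‖w.1‖)) ≥ μ₀)
    (κ : ℝ) (hκ₀ : 0 < κ) (hκ₂ : κ < 2)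
    (hβsum : Summable (fun j => ‖T.comp (A j)‖))
    (hκ : (∑' j, ‖T.comp (A j)‖) ≤ κ)
    (y : ℕ → ℝ) (hy : ∀ j, y j ∈ Set.Icc (-(1/2) : ℝ) (1/2)) :
    ((⨅ v : {v : X // v ≠ 0}, ⨆ w : {w : Y // w ≠ 0},
        (A₀ v.1 w.1 + ∑' j, y j * A j v.1 w.1) / (‖v.1‖ * ‖w.1‖))
      ≥ (1 - κ / 2) * μ₀)
    ∧ ((⨅ w : {w : Y // w ≠ 0}, ⨆ v : {v : X // v ≠ 0},
        (A₀ v.1 w.1 + ∑' j, y j * A j v.1 w.1) / (‖v.1‖ * ‖w.1‖))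
      ≥ (1 - κ / 2) * μ₀) := by
  have hX : Nontrivial X := nontrivial_of_iInf_pos (hμ₀.trans_le hinfsup₁)
  have hY : Nontrivial Y := nontrivial_of_iInf_pos (hμ₀.trans_le hinfsup₂)
  have hbound : ∀ j, ‖y j • T.comp (A j)‖ ≤ 1 / 2 * ‖T.comp (A j)‖ := fun j => by
    rw [norm_smul]
    exact mul_le_mul_of_nonneg_right (abs_le.2 (hy j)) (norm_nonneg _)
  have hsum : Summable fun j => y j • T.comp (A j) :=
    (hβsum.mul_left (1 / 2)).of_norm_bounded hbound
  obtain ⟨B, hB⟩ := hsum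
  have hBnorm : ‖B‖ ≤ κ / 2 := by
    rw [← hB.tsum_eq]
    refine (tsum_of_norm_bounded (hβsum.hasSum.mul_left (1 / 2)) hbound).trans ?_
    linarith
  have hform : ∀ v w, A₀ v w + ∑' j, y j * A j v w =
      A₀.comp (ContinuousLinearMap.id ℝ X + B) v w := by
    intro v w
    have h := ((A₀.flip w).comp (ContinuousLinearMap.apply ℝ X v)).hasSum hB
    have h' : HasSum (fun j => y j * A j v w) (A₀ (B v) w) := by
      simpa [hT₂] using h
    simp [h'.tsum_eq]
  simp only [hform, ge_iff_le]
  rw [ge_iff_le, le_iInf_iSup_div_norm_iff] at hinfsup₁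
  have hflip : ∀ (F : X →L[ℝ] Y →L[ℝ] ℝ) (v : X) (w : Y),
      F v w / (‖v‖ * ‖w‖) = F.flip w v / (‖w‖ * ‖v‖) := fun F v w => by
    rw [mul_comm, F.flip_apply]
  simp only [hflip, ge_iff_le] at hinfsup₂
  rw [le_iInf_iSup_div_norm_iff] at hinfsup₂
  refine ⟨(le_iInf_iSup_div_norm_iff _ _).2 fun v => ?_, ?_⟩
  · have h₁ : ‖v‖ - ‖B v‖ ≤ ‖v + B v‖ := by simpa using norm_sub_norm_le v (-B v)
    have h₂ : ‖B v‖ ≤ κ / 2 * ‖v‖ := B.le_of_opNorm_le hBnorm v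
    calc (1 - κ / 2) * μ₀ * ‖v‖ = μ₀ * (‖v‖ - κ / 2 * ‖v‖) := by ring
      _ ≤ μ₀ * ‖v + B v‖ := by gcongr; linarith
      _ ≤ ‖A₀ (v + B v)‖ := hinfsup₁ _
  · simp only [hflip]
    refine (le_iInf_iSup_div_norm_iff _ _).2 fun w => ?_
    have heq : (A₀.comp (ContinuousLinearMap.id ℝ X + B)).flip w =
        A₀.flip w + (A₀.flip w).comp B := by
      ext v
      simp
    have h₁ : ‖A₀.flip w‖ - ‖(A₀.flip w).comp B‖ ≤ ‖A₀.flip w + (A₀.flip w).comp B‖ := by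
      simpa using norm_sub_norm_le (A₀.flip w) (-(A₀.flip w).comp B)
    have h₂ : ‖(A₀.flip w).comp B‖ ≤ ‖A₀.flip w‖ * (κ / 2) :=
      ((A₀.flip w).opNorm_comp_le B).trans (by gcongr)
    rw [heq]
    calc (1 - κ / 2) * μ₀ * ‖w‖ = (1 - κ / 2) * (μ₀ * ‖w‖) := by ring
      _ ≤ (1 - κ / 2) * ‖A₀.flip w‖ :=
        mul_le_mul_of_nonneg_left (hinfsup₂ w) (by linarith)
      _ ≤ ‖A₀.flip w + (A₀.flip w).comp B‖ := by linarith
end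

section
/- Under the stated assumptions, for every f ∈ Y' and every y ∈ U = [-1/2,1/2]^ℕ, the parametric variational problem: find u(y) ∈ X such that a(y; u(y), w) = ⟨w, f⟩ for all w ∈ Y, admits a unique solution u(y), and this solution satisfies the a-priori estimate ‖u(y)‖_X ≤ ‖f‖_{Y'} / μ, where μ = (1 - κ/2)·μ₀. -/
/-- An inf-sup condition with constant `μ` bounds the operator from below by `μ`. -/
theorem mul_norm_le_norm_apply_of_infSup
    {X Y : Type*} [NormedAddCommGroup X] [NormedSpace ℝ X]
    [NormedAddCommGroup Y] [NormedSpace ℝ Y]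
    {A : X →L[ℝ] Y →L[ℝ] ℝ} {μ : ℝ} (hμ : 0 < μ)
    (h : μ ≤ ⨅ v : {v : X // v ≠ 0}, ⨆ w : {w : Y // w ≠ 0},
        A v.1 w.1 / (‖v.1‖ * ‖w.1‖)) (v : X) :
    μ * ‖v‖ ≤ ‖A v‖ := by
  rcases eq_or_ne v 0 with rfl | hv
  · simp
  have hbdd : BddBelow (Set.range fun v : {v : X // v ≠ 0} => ⨆ w : {w : Y // w ≠ 0},
      A v.1 w.1 / (‖v.1‖ * ‖w.1‖)) := by
    by_contra hb
    rw [Real.iInf_of_not_bddBelow hb] at h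
    linarith
  have hv' : 0 < ‖v‖ := norm_pos_iff.mpr hv
  rw [← le_div_iff₀ hv']
  refine (h.trans (ciInf_le hbdd ⟨v, hv⟩)).trans (Real.iSup_le (fun w => ?_) (by positivity))
  have hw : 0 < ‖w.1‖ := norm_pos_iff.mpr w.2
  rw [div_le_div_iff₀ (by positivity) hv']
  calc A v w.1 * ‖v‖ ≤ (‖A v‖ * ‖w.1‖) * ‖v‖ := by
        gcongr
        exact (le_abs_self _).trans ((A v).le_opNorm w.1)
    _ = ‖A v‖ * (‖v‖ * ‖w.1‖) := by ring

/-- If `‖B‖ ≤ c < 1`, then `u + B u = g` has a unique solution, bounded by `‖g‖ / (1 - c)`. -/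
theorem exists_unique_add_apply_eq
    {X : Type*} [NormedAddCommGroup X] [NormedSpace ℝ X] [CompleteSpace X]
    (B : X →L[ℝ] X) {c : ℝ} (hB : ‖B‖ ≤ c) (hc : c < 1) (g : X) :
    ∃ u : X, u + B u = g ∧ ‖u‖ ≤ ‖g‖ / (1 - c) ∧ ∀ u' : X, u' + B u' = g → u' = u := by
  have hbound (v : X) : (1 - c) * ‖v‖ ≤ ‖v + B v‖ := by
    have h₁ : ‖B v‖ ≤ c * ‖v‖ := B.le_of_opNorm_le hB v
    have h₂ : ‖v‖ ≤ ‖v + B v‖ + ‖B v‖ := by simpa using norm_sub_le (v + B v) (B v)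
    linarith
  let U : (X →L[ℝ] X)ˣ := Units.oneSub (-B) (by rw [norm_neg]; linarith)
  have hU (v : X) : (U : X →L[ℝ] X) v = v + B v := by simp [U]
  have hu : (U⁻¹.1 g) + B (U⁻¹.1 g) = g := by
    rw [← hU, ← mul_apply_eq_comp, U.mul_inv, one_apply_eq_self]
  refine ⟨U⁻¹.1 g, hu, ?_, fun u' hu' => ?_⟩
  · rw [le_div_iff₀ (by linarith), mul_comm]
    simpa only [hu] using hbound (U⁻¹.1 g)
  · rw [← hu', ← hU, ← mul_apply_eq_comp, U.inv_mul,
      one_apply_eq_self]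

/-- **Well-posedness of the parametric operator equation.**
Under the inf-sup assumptions on the nominal operator `A₀` and the smallness
assumption `∑ βⱼ ≤ κ < 2` on the fluctuations, for every `f ∈ Y'` and every
`y ∈ U = [-1/2,1/2]^ℕ` the problem `a(y; u, w) = ⟨w, f⟩ ∀ w ∈ Y` has a unique
solution `u(y)`, which satisfies `‖u(y)‖_X ≤ ‖f‖_{Y'} / ((1-κ/2) μ₀)`. -/
theorem parametric_wellposed
    {X Y : Type*} [NormedAddCommGroup X] [NormedSpace ℝ X] [CompleteSpace X]
    [TopologicalSpace.SeparableSpace X]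
    [NormedAddCommGroup Y] [NormedSpace ℝ Y] [CompleteSpace Y]
    [TopologicalSpace.SeparableSpace Y]
    (A₀ : X →L[ℝ] Y →L[ℝ] ℝ) (A : ℕ → X →L[ℝ] Y →L[ℝ] ℝ)
    (T : (Y →L[ℝ] ℝ) →L[ℝ] X)
    (hT₁ : ∀ v : X, T (A₀ v) = v) (hT₂ : ∀ g : Y →L[ℝ] ℝ, A₀ (T g) = g)
    (μ₀ : ℝ) (hμ₀ : 0 < μ₀)
    (hinfsup₁ : (⨅ v : {v : X // v ≠ 0}, ⨆ w : {w : Y // w ≠ 0},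
        A₀ v.1 w.1 / (‖v.1‖ * ‖w.1‖)) ≥ μ₀)
    (hinfsup₂ : (⨅ w : {w : Y // w ≠ 0}, ⨆ v : {v : X // v ≠ 0},
        A₀ v.1 w.1 / (‖v.1‖ * ‖w.1‖)) ≥ μ₀)
    (κ : ℝ) (hκ₀ : 0 < κ) (hκ₂ : κ < 2)
    (hβsum : Summable (fun j => ‖T.comp (A j)‖))
    (hκ : (∑' j, ‖T.comp (A j)‖) ≤ κ)
    (f : Y →L[ℝ] ℝ)
    (y : ℕ → ℝ) (hy : ∀ j, y j ∈ Set.Icc (-(1/2) : ℝ) (1/2)) :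
    ∃ u : X,
      (∀ w : Y, A₀ u w + ∑' j, y j * A j u w = f w) ∧
      ‖u‖ ≤ ‖f‖ / ((1 - κ / 2) * μ₀) ∧
      (∀ u' : X, (∀ w : Y, A₀ u' w + ∑' j, y j * A j u' w = f w) → u' = u) := by
  have hy' (j : ℕ) : ‖y j • T.comp (A j)‖ ≤ ‖T.comp (A j)‖ / 2 := by
    have hyj : ‖y j‖ ≤ 1 / 2 := abs_le.mpr (hy j)
    rw [norm_smul]
    nlinarith [norm_nonneg (T.comp (A j))]
  have hs : Summable fun j => y j • T.comp (A j) :=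
    Summable.of_norm_bounded (hβsum.div_const 2) hy'
  set B : X →L[ℝ] X := ∑' j, y j • T.comp (A j) with hBdef
  have hB : ‖B‖ ≤ κ / 2 := by
    refine (tsum_of_norm_bounded (hβsum.div_const 2).hasSum hy').trans ?_
    rw [tsum_div_const]
    linarith
  have hAB (u : X) (w : Y) : ∑' j, y j * A j u w = A₀ (B u) w := by
    have h := ((hs.hasSum.mapL (ContinuousLinearMap.apply ℝ X u)).mapL A₀).mapL
      (ContinuousLinearMap.apply ℝ ℝ w)
    simpa [hT₂] using h.tsum_eq
  have heq (u : X) : (∀ w : Y, A₀ u w + ∑' j, y j * A j u w = f w) ↔ u + B u = T f := by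
    simp only [hAB]
    constructor
    · intro h
      have hf : A₀ (u + B u) = f := by
        ext w
        simpa using h w
      rw [← hf, hT₁]
    · intro h w
      rw [← hT₂ f, ← h]
      simp
  obtain ⟨u, hu, hnorm, huniq⟩ := exists_unique_add_apply_eq B hB (by linarith) (T f)
  refine ⟨u, (heq u).2 hu, hnorm.trans ?_, fun u' hu' => huniq u' ((heq u').1 hu')⟩
  have hTf : ‖T f‖ ≤ ‖f‖ / μ₀ := by
    rw [le_div_iff₀ hμ₀, mul_comm]
    simpa only [hT₂] using mul_norm_le_norm_apply_of_infSup hμ₀ hinfsup₁ (T f)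
  rw [mul_comm, ← div_div]
  have hκ' : 0 < 1 - κ / 2 := by linarith
  gcongr
end

section
/- Under the stated assumptions, there exists a constant C > 0 independent of f such that for every f ∈ Y', every y ∈ U, and every s ∈ ℕ, the dimensionally truncated solution u_s(y) (the solution corresponding to the parameter vector with y_j replaced by 0 for all j > s) satisfies ‖u(y) - u_s(y)‖_X ≤ (C/μ) · ‖f‖_{Y'} · Σ_{j ≥ s+1} β_j, where μ = (1 - κ/2)·μ₀. -/
/-- Norm bound for a weighted series of operators whose terms are dominated by a summable sequence. -/
lemma norm_tsum_smul_apply_le {X : Type*} [NormedAddCommGroup X] [NormedSpace ℝ X]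
    {B : ℕ → X →L[ℝ] X} {c b : ℕ → ℝ} (hb : Summable b)
    (hcb : ∀ j, |c j| * ‖B j‖ ≤ b j) (x : X) :
    ‖∑' j, c j • B j x‖ ≤ (∑' j, b j) * ‖x‖ := by
  refine tsum_of_norm_bounded (hb.hasSum.mul_right ‖x‖) fun j => ?_
  calc ‖c j • B j x‖ = |c j| * ‖B j x‖ := by rw [norm_smul, Real.norm_eq_abs]
    _ ≤ |c j| * (‖B j‖ * ‖x‖) := by gcongr; exact (B j).le_opNorm x
    _ = |c j| * ‖B j‖ * ‖x‖ := by ring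
    _ ≤ b j * ‖x‖ := by gcongr; exact hcb j

lemma summable_smul_apply {X Z : Type*} [NormedAddCommGroup X] [NormedSpace ℝ X]
    [NormedAddCommGroup Z] [NormedSpace ℝ Z] [CompleteSpace Z]
    {B : ℕ → X →L[ℝ] Z} (hB : Summable fun j => ‖B j‖) {y : ℕ → ℝ}
    (hy : ∀ j, |y j| ≤ 1 / 2) (x : X) : Summable fun j => y j • B j x := by
  refine Summable.of_norm_bounded ((hB.mul_left (1 / 2)).mul_right ‖x‖) fun j => ?_
  calc ‖y j • B j x‖ = |y j| * ‖B j x‖ := by rw [norm_smul, Real.norm_eq_abs]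
    _ ≤ 1 / 2 * (‖B j‖ * ‖x‖) := by gcongr; exacts [hy j, (B j).le_opNorm x]
    _ = 1 / 2 * ‖B j‖ * ‖x‖ := by ring

/-- Stability of the perturbed identity `1 + ∑ y_j B_j`. -/
lemma norm_mul_le_of_add_tsum_eq {X : Type*} [NormedAddCommGroup X] [NormedSpace ℝ X]
    {B : ℕ → X →L[ℝ] X} (hB : Summable fun j => ‖B j‖) {κ : ℝ}
    (hκ : ∑' j, ‖B j‖ ≤ κ) {y : ℕ → ℝ} (hy : ∀ j, |y j| ≤ 1 / 2) {x g : X}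
    (h : x + ∑' j, y j • B j x = g) : (1 - κ / 2) * ‖x‖ ≤ ‖g‖ := by
  have hsum := norm_tsum_smul_apply_le (c := y) (hB.mul_left (1 / 2))
    (fun j => mul_le_mul_of_nonneg_right (hy j) (norm_nonneg _)) x
  rw [tsum_mul_left] at hsum
  have hx : ‖x‖ ≤ ‖g‖ + ‖∑' j, y j • B j x‖ := by
    rw [← h]
    simpa using norm_sub_le (x + ∑' j, y j • B j x) (∑' j, y j • B j x)
  have := mul_le_mul_of_nonneg_right hκ (norm_nonneg x)
  linarith

/-- Truncation error for solutions of `x + ∑ y_j B_j x = g`. -/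
lemma norm_sub_truncation_le {X : Type*} [NormedAddCommGroup X] [NormedSpace ℝ X]
    [CompleteSpace X] {B : ℕ → X →L[ℝ] X} (hB : Summable fun j => ‖B j‖) {κ : ℝ}
    (hκ₂ : κ < 2) (hκ : ∑' j, ‖B j‖ ≤ κ) {y : ℕ → ℝ} (hy : ∀ j, |y j| ≤ 1 / 2) (s : ℕ)
    {x z g : X} (hx : x + ∑' j, y j • B j x = g)
    (hz : z + ∑' j, (if j < s then y j else 0) • B j z = g) :
    ‖x - z‖ ≤ ‖g‖ / (2 * (1 - κ / 2) ^ 2) * ∑' j : {j : ℕ // s ≤ j}, ‖B j.1‖ := by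
  have hy' : ∀ j, |if j < s then y j else 0| ≤ 1 / 2 := by
    intro j
    split_ifs
    · exact hy j
    · norm_num
  have htail : ∑' j : {j : ℕ // s ≤ j}, ‖B j.1‖ =
      ∑' j, Set.indicator {j | s ≤ j} (fun j => ‖B j‖) j :=
    tsum_subtype {j | s ≤ j} fun j => ‖B j‖
  have htail₀ : 0 ≤ ∑' j : {j : ℕ // s ≤ j}, ‖B j.1‖ := tsum_nonneg fun _ => norm_nonneg _
  have hres : ‖∑' j, ((if j < s then y j else 0) - y j) • B j z‖ ≤
      1 / 2 * (∑' j : {j : ℕ // s ≤ j}, ‖B j.1‖) * ‖z‖ := by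
    rw [htail, ← tsum_mul_left]
    refine norm_tsum_smul_apply_le ((hB.indicator _).mul_left _) (fun j => ?_) z
    by_cases hj : j < s
    · simp [hj]
    · have := mul_le_mul_of_nonneg_right (hy j) (norm_nonneg (B j))
      simpa [hj, not_lt.mp hj] using this
  have hdiff : (x - z) + ∑' j, y j • B j (x - z) =
      ∑' j, ((if j < s then y j else 0) - y j) • B j z := by
    simp only [map_sub, smul_sub, sub_smul]
    rw [(summable_smul_apply hB hy x).tsum_sub (summable_smul_apply hB hy z),
      (summable_smul_apply hB hy' z).tsum_sub (summable_smul_apply hB hy z)]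
    have hxz := sub_eq_zero.mpr (hx.trans hz.symm)
    rw [← sub_eq_zero, ← hxz]
    abel
  have hstab := norm_mul_le_of_add_tsum_eq hB hκ hy hdiff
  have hz_le := norm_mul_le_of_add_tsum_eq hB hκ hy' hz
  have hpos : 0 < 1 - κ / 2 := by linarith
  rw [div_mul_eq_mul_div, le_div_iff₀ (by positivity)]
  have h₁ := mul_le_mul_of_nonneg_left (hstab.trans hres) hpos.le
  have h₂ := mul_le_mul_of_nonneg_right hz_le htail₀
  linarith

/-- The variational problem, preconditioned by the inverse `T` of `A₀`. -/
lemma add_tsum_comp_eq_of_variational {X Y : Type*} [NormedAddCommGroup X] [NormedSpace ℝ X]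
    [NormedAddCommGroup Y] [NormedSpace ℝ Y]
    {A₀ : X →L[ℝ] Y →L[ℝ] ℝ} {A : ℕ → X →L[ℝ] Y →L[ℝ] ℝ} {T : (Y →L[ℝ] ℝ) →L[ℝ] X}
    (hT₁ : ∀ v : X, T (A₀ v) = v) (hT₂ : ∀ g : Y →L[ℝ] ℝ, A₀ (T g) = g)
    (hB : Summable fun j => ‖T.comp (A j)‖) {y : ℕ → ℝ} (hy : ∀ j, |y j| ≤ 1 / 2)
    {x : X} {f : Y →L[ℝ] ℝ} (h : ∀ w : Y, A₀ x w + ∑' j, y j * A j x w = f w) :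
    x + ∑' j, y j • (T.comp (A j)) x = T f := by
  have hA : Summable fun j => ‖A j‖ := by
    refine Summable.of_nonneg_of_le (fun j => norm_nonneg (A j)) (fun j => ?_) (hB.mul_left ‖A₀‖)
    have hj : A j = A₀.comp (T.comp (A j)) := by
      ext v w
      simp [hT₂]
    calc ‖A j‖ = ‖A₀.comp (T.comp (A j))‖ := by rw [← hj]
      _ ≤ ‖A₀‖ * ‖T.comp (A j)‖ := A₀.opNorm_comp_le _
  have hS := summable_smul_apply hA hy x
  have hf : A₀ x + ∑' j, y j • A j x = f := by
    ext w
    have hw := (ContinuousLinearMap.apply ℝ ℝ w).map_tsum hS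
    simp only [ContinuousLinearMap.apply_apply, smul_apply,
      smul_eq_mul] at hw
    rw [add_apply, hw, h w]
  rw [← hf, map_add, hT₁, T.map_tsum hS]
  simp


/-- **Dimension truncation error for the parametric solution.**
There is a constant `C > 0`, independent of `f`, such that for every `f ∈ Y'`,
every `y ∈ U = [-1/2,1/2]^ℕ` and every `s ∈ ℕ`, the solution `u_s(y)` of the
`s`-term truncated problem (obtained by setting all coordinates of `y` beyond
the first `s` to `0`) satisfies
`‖u(y) - u_s(y)‖_X ≤ (C/μ) ‖f‖_{Y'} ∑_{j ≥ s+1} β_j`, with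
`μ = (1 - κ/2) μ₀` and `β_j = ‖A₀⁻¹ A_j‖`. -/
theorem dimension_truncation
    {X Y : Type*} [NormedAddCommGroup X] [NormedSpace ℝ X] [CompleteSpace X]
    [TopologicalSpace.SeparableSpace X]
    [NormedAddCommGroup Y] [NormedSpace ℝ Y] [CompleteSpace Y]
    [TopologicalSpace.SeparableSpace Y]
    (A₀ : X →L[ℝ] Y →L[ℝ] ℝ) (A : ℕ → X →L[ℝ] Y →L[ℝ] ℝ)
    (T : (Y →L[ℝ] ℝ) →L[ℝ] X)
    (hT₁ : ∀ v : X, T (A₀ v) = v) (hT₂ : ∀ g : Y →L[ℝ] ℝ, A₀ (T g) = g)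
    (μ₀ : ℝ) (hμ₀ : 0 < μ₀)
    (hinfsup₁ : (⨅ v : {v : X // v ≠ 0}, ⨆ w : {w : Y // w ≠ 0},
        A₀ v.1 w.1 / (‖v.1‖ * ‖w.1‖)) ≥ μ₀)
    (hinfsup₂ : (⨅ w : {w : Y // w ≠ 0}, ⨆ v : {v : X // v ≠ 0},
        A₀ v.1 w.1 / (‖v.1‖ * ‖w.1‖)) ≥ μ₀)
    (κ : ℝ) (hκ₀ : 0 < κ) (hκ₂ : κ < 2)
    (hβsum : Summable (fun j => ‖T.comp (A j)‖))
    (hκ : (∑' j, ‖T.comp (A j)‖) ≤ κ)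
    -- `u f y` is the solution of the parametric problem with right hand side `f`
    (u : (Y →L[ℝ] ℝ) → (ℕ → ℝ) → X)
    (hu : ∀ (f : Y →L[ℝ] ℝ) (y : ℕ → ℝ),
      (∀ j, y j ∈ Set.Icc (-(1/2) : ℝ) (1/2)) →
      ∀ w : Y, A₀ (u f y) w + ∑' j, y j * A j (u f y) w = f w) :
    ∃ C : ℝ, 0 < C ∧
      ∀ (f : Y →L[ℝ] ℝ) (y : ℕ → ℝ),
        (∀ j, y j ∈ Set.Icc (-(1/2) : ℝ) (1/2)) →
        ∀ s : ℕ,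
          ‖u f y - u f (fun j => if j < s then y j else 0)‖ ≤
            C / ((1 - κ / 2) * μ₀) * ‖f‖ *
              ∑' j : {j : ℕ // s ≤ j}, ‖T.comp (A j.1)‖ := by
  have hpos : 0 < 1 - κ / 2 := by linarith
  refine ⟨(‖T‖ * μ₀ + 1) / (2 * (1 - κ / 2)), by positivity, fun f y hy s => ?_⟩
  have hy' : ∀ j, (if j < s then y j else 0) ∈ Set.Icc (-(1/2) : ℝ) (1/2) := by
    intro j
    split_ifs
    · exact hy j
    · norm_num
  have hbound := norm_sub_truncation_le hβsum hκ₂ hκ (fun j => abs_le.mpr (hy j)) s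
    (add_tsum_comp_eq_of_variational hT₁ hT₂ hβsum (fun j => abs_le.mpr (hy j)) (hu f y hy))
    (add_tsum_comp_eq_of_variational hT₁ hT₂ hβsum (fun j => abs_le.mpr (hy' j))
      (hu f _ hy'))
  refine hbound.trans (mul_le_mul_of_nonneg_right ?_ (tsum_nonneg fun _ => norm_nonneg _))
  have hTf : ‖T f‖ ≤ (‖T‖ * μ₀ + 1) / μ₀ * ‖f‖ := by
    refine (T.le_opNorm f).trans (mul_le_mul_of_nonneg_right ?_ (norm_nonneg f))
    rw [le_div_iff₀ hμ₀]
    linarith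
  calc ‖T f‖ / (2 * (1 - κ / 2) ^ 2)
      ≤ (‖T‖ * μ₀ + 1) / μ₀ * ‖f‖ / (2 * (1 - κ / 2) ^ 2) := by gcongr
    _ = (‖T‖ * μ₀ + 1) / (2 * (1 - κ / 2)) / ((1 - κ / 2) * μ₀) * ‖f‖ := by
      field_simp
end

section
/- Let 0 < p < 1 and let (β_j)_{j≥1} be a non-increasing sequence of nonnegative real numbers with Σ_{j≥1} β_j^p < ∞. Then for every s ∈ ℕ with s ≥ 1, Σ_{j ≥ s+1} β_j ≤ min(1/(1/p - 1), 1) · (Σ_{j≥1} β_j^p)^{1/p} · s^{-(1/p - 1)}. -/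
/-- The `n`-th term of a non-increasing nonnegative sequence satisfies
`β_n^p ≤ (∑ β_j^p) / (n + 1)`. -/
theorem rpow_le_tsum_rpow_div {p : ℝ} (hp0 : 0 < p) {β : ℕ → ℝ} (hβnn : ∀ j, 0 ≤ β j)
    (hβ : Antitone β) (hsum : Summable fun j => β j ^ p) (n : ℕ) :
    β n ^ p ≤ (∑' j, β j ^ p) / ((n : ℝ) + 1) := by
  rw [le_div_iff₀ (by positivity)]
  have h := hsum.sum_le_tsum (Finset.range (n + 1))
    (fun j _ => Real.rpow_nonneg (hβnn j) p)
  have h' : ((Finset.range (n + 1)).card : ℕ) • (β n ^ p) ≤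
      ∑ j ∈ Finset.range (n + 1), β j ^ p :=
    Finset.card_nsmul_le_sum _ _ _ fun j hj =>
      Real.rpow_le_rpow (hβnn n) (hβ (Nat.lt_succ_iff.mp (Finset.mem_range.mp hj))) hp0.le
  rw [Finset.card_range, nsmul_eq_mul] at h'
  push_cast at h'
  linarith

/-- The discrete integral comparison `a (x + 1)^(-a-1) ≤ x^(-a) - (x + 1)^(-a)`. -/
theorem mul_rpow_le_rpow_sub_rpow {a x : ℝ} (ha : 0 < a) (hx : 0 < x) :
    a * (x + 1) ^ (-(a + 1)) ≤ x ^ (-a) - (x + 1) ^ (-a) := by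
  have hx1 : 0 < x + 1 := by linarith
  have hq : 0 < x / (x + 1) := by positivity
  have hlog := Real.log_le_sub_one_of_pos hq
  have hexp := Real.add_one_le_exp (Real.log (x / (x + 1)) * -a)
  rw [← Real.rpow_def_of_pos hq, Real.div_rpow hx.le hx1.le] at hexp
  have hsub : x / (x + 1) - 1 = -(x + 1)⁻¹ := by field_simp; ring
  rw [hsub] at hlog
  have hbern : a * (x + 1)⁻¹ + 1 ≤ x ^ (-a) / (x + 1) ^ (-a) := by nlinarith
  have hpos : 0 < (x + 1) ^ (-a) := Real.rpow_pos_of_pos hx1 _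
  rw [le_div_iff₀ hpos] at hbern
  have hsplit : (x + 1) ^ (-(a + 1)) = (x + 1) ^ (-a) * (x + 1)⁻¹ := by
    rw [neg_add, Real.rpow_add hx1, Real.rpow_neg_one]
  rw [hsplit]
  linarith

/-- The tail of the series `∑ n^(-a-1)` is at most `s^(-a) / a`. -/
theorem sum_range_rpow_le {a : ℝ} (ha : 0 < a) {s : ℕ} (hs : 1 ≤ s) (n : ℕ) :
    ∑ i ∈ Finset.range n, (((i + s : ℕ) : ℝ) + 1) ^ (-(a + 1)) ≤ 1 / a * (s : ℝ) ^ (-a) := by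
  rw [one_div, inv_mul_eq_div, le_div_iff₀' ha, Finset.mul_sum]
  calc ∑ i ∈ Finset.range n, a * (((i + s : ℕ) : ℝ) + 1) ^ (-(a + 1))
      ≤ ∑ i ∈ Finset.range n,
          (((i + s : ℕ) : ℝ) ^ (-a) - ((i + 1 + s : ℕ) : ℝ) ^ (-a)) := by
        refine Finset.sum_le_sum fun i _ => ?_
        have h := mul_rpow_le_rpow_sub_rpow ha (x := ((i + s : ℕ) : ℝ))
          (by exact_mod_cast (by omega : 0 < i + s))
        rwa [show ((i + 1 + s : ℕ) : ℝ) = ((i + s : ℕ) : ℝ) + 1 by push_cast; ring]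
    _ = ((0 + s : ℕ) : ℝ) ^ (-a) - ((n + s : ℕ) : ℝ) ^ (-a) :=
        Finset.sum_range_sub' (fun i => ((i + s : ℕ) : ℝ) ^ (-a)) n
    _ ≤ (s : ℝ) ^ (-a) := by
        rw [zero_add]
        exact sub_le_self _ (by positivity)

/-- **Tail bound for a non-increasing `p`-summable sequence.**
If `0 < p < 1` and `(β_j)_{j≥1}` is non-increasing, nonnegative and
`p`-summable (here `β j` stands for the paper's `β_{j+1}`, `j : ℕ`), then for
every `s ≥ 1`,
`∑_{j≥s+1} β_j ≤ min (1/(1/p-1)) 1 · (∑_{j≥1} β_j^p)^{1/p} · s^{-(1/p-1)}`. -/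
theorem tail_sum_bound (p : ℝ) (hp0 : 0 < p) (hp1 : p < 1)
    (β : ℕ → ℝ) (hβnn : ∀ j, 0 ≤ β j) (hmono : ∀ j, β (j + 1) ≤ β j)
    (hsum : Summable fun j => β j ^ p) :
    ∀ s : ℕ, 1 ≤ s →
      (∑' j : {j : ℕ // s ≤ j}, β j.1) ≤
        min (1 / (1 / p - 1)) 1 * (∑' j, β j ^ p) ^ (1 / p) *
          (s : ℝ) ^ (-(1 / p - 1)) := by
  intro s hs
  have hβ : Antitone β := antitone_nat_of_succ_le hmono
  have ha : 0 < 1 / p - 1 := sub_pos.mpr ((one_lt_div hp0).mpr hp1)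
  have hs0 : (0 : ℝ) < s := by exact_mod_cast hs
  have hS : 0 ≤ ∑' j, β j ^ p := tsum_nonneg fun j => Real.rpow_nonneg (hβnn j) p
  have hdecay := rpow_le_tsum_rpow_div hp0 hβnn hβ hsum
  set S := ∑' j, β j ^ p
  set a := 1 / p - 1 with ha_def
  have hpa : 1 / p = a + 1 := by rw [ha_def]; ring
  let e : ℕ ≃ {j : ℕ // s ≤ j} :=
    { toFun := fun i => ⟨i + s, Nat.le_add_left s i⟩
      invFun := fun j => j.1 - s
      left_inv := fun i => Nat.add_sub_cancel i s
      right_inv := fun j => Subtype.ext (Nat.sub_add_cancel j.2) }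
  rw [← e.tsum_eq]
  refine Real.tsum_le_of_sum_range_le (fun i => hβnn _) fun n => ?_
  change ∑ i ∈ Finset.range n, β (i + s) ≤ _
  rcases min_choice (1 / a) 1 with h | h <;> rw [h]
  · calc ∑ i ∈ Finset.range n, β (i + s)
        ≤ ∑ i ∈ Finset.range n, S ^ (1 / p) * (((i + s : ℕ) : ℝ) + 1) ^ (-(a + 1)) := by
          refine Finset.sum_le_sum fun i _ => ?_
          have hx : (0 : ℝ) ≤ ((i + s : ℕ) : ℝ) + 1 := by positivity
          have h := Real.rpow_le_rpow (Real.rpow_nonneg (hβnn _) p) (hdecay (i + s))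
            (one_div_pos.mpr hp0).le
          rwa [one_div, Real.rpow_rpow_inv (hβnn _) hp0.ne', ← one_div,
            Real.div_rpow hS hx, div_eq_mul_inv, ← Real.rpow_neg hx,
            show -(1 / p) = -(a + 1) by rw [hpa]] at h
      _ ≤ S ^ (1 / p) * (1 / a * (s : ℝ) ^ (-a)) := by
          rw [← Finset.mul_sum]
          exact mul_le_mul_of_nonneg_left (sum_range_rpow_le ha hs n) (by positivity)
      _ = 1 / a * S ^ (1 / p) * (s : ℝ) ^ (-a) := by ring
  · have hle : ∀ i, β (i + s) ≤ β (i + s) ^ p * (S / s) ^ a := by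
      intro i
      have h1 : β (i + s) ^ p ≤ S / s := by
        refine (hdecay (i + s)).trans (div_le_div_of_nonneg_left hS hs0 ?_)
        push_cast
        linarith [(Nat.cast_nonneg i : (0 : ℝ) ≤ i)]
      have hx : 0 ≤ β (i + s) ^ p := Real.rpow_nonneg (hβnn _) p
      calc β (i + s) = (β (i + s) ^ p) ^ (1 + a) := by
            rw [add_comm 1 a, ← hpa, one_div, Real.rpow_rpow_inv (hβnn _) hp0.ne']
        _ = β (i + s) ^ p * (β (i + s) ^ p) ^ a := by
            rw [Real.rpow_add_of_nonneg hx zero_le_one ha.le, Real.rpow_one]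
        _ ≤ β (i + s) ^ p * (S / s) ^ a :=
            mul_le_mul_of_nonneg_left (Real.rpow_le_rpow hx h1 ha.le) hx
    have htail : ∑ i ∈ Finset.range n, β (i + s) ^ p ≤ S := by
      have h := hsum.sum_le_tsum ((Finset.range n).map (addRightEmbedding s))
        fun j _ => Real.rpow_nonneg (hβnn j) p
      rwa [Finset.sum_map] at h
    calc ∑ i ∈ Finset.range n, β (i + s)
        ≤ ∑ i ∈ Finset.range n, β (i + s) ^ p * (S / s) ^ a :=
          Finset.sum_le_sum fun i _ => hle i
      _ ≤ S * (S / s) ^ a := by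
          rw [← Finset.sum_mul]
          exact mul_le_mul_of_nonneg_right htail (by positivity)
      _ = 1 * S ^ (1 / p) * (s : ℝ) ^ (-a) := by
          rw [hpa, add_comm a 1, Real.rpow_add_of_nonneg hS zero_le_one ha.le, Real.rpow_one,
            Real.div_rpow hS hs0.le, Real.rpow_neg hs0.le]
          ring
end

section
/- Let b ≥ 2 and m ≥ 1 be integers and c > 1 a real number. Then Σ_{k=1}^∞ b^{-c·μ₁(k·b^m)} = b^{-cm}·(b-1)/(b^c - b), where μ₁ denotes the number of base-b digits. Equivalently, the sum of b^{-c·μ₁(ℓ)} over all positive integers ℓ divisible by b^m equals b^{-cm}(b-1)/(b^c-b). -/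
/-- `mu1 b k` is the number of digits in the base-`b` expansion of `k`, i.e.
the unique `a` with `b^(a-1) ≤ k < b^a` for `k ≥ 1`, and `mu1 b 0 = 0`. -/
def mu1 (b k : ℕ) : ℕ := if k = 0 then 0 else Nat.log b k + 1

/-- Summation by fibres: a function of `f x` sums to the sum of its values weighted by the sizes
of the fibres of `f`. -/
theorem hasSum_comp_of_hasSum_card_fiber {α β : Type*} {f : α → β} {g : β → ℝ} {s : ℝ}
    (hg : ∀ n, 0 ≤ g n) (hfin : ∀ n, Finite {x // f x = n})
    (h : HasSum (fun n => (Nat.card {x // f x = n} : ℝ) * g n) s) :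
    HasSum (fun x => g (f x)) s := by
  rw [← (Equiv.sigmaFiberEquiv f).hasSum_iff]
  have hfib (n : β) : HasSum (fun x : {x // f x = n} => g (f x))
      ((Nat.card {x // f x = n} : ℝ) * g n) := by
    have := Fintype.ofFinite {x // f x = n}
    convert hasSum_fintype (fun x : {x // f x = n} => g (f x)) using 1
    rw [Finset.sum_congr rfl fun x _ => congrArg g x.2]
    simp
  refine h.sigma_of_hasSum hfib ((summable_sigma_of_nonneg fun x => hg _).2 ⟨?_, ?_⟩)
  · exact fun n => (hfib n).summable
  · exact h.summable.congr fun n => ((hfib n).tsum_eq).symm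

/-- The positive integers with `Nat.log b k = n` are those in `[b ^ n, b ^ (n + 1))`. -/
def logFiberEquiv {b : ℕ} (hb : 2 ≤ b) (n : ℕ) :
    {k : {k : ℕ // 0 < k} // Nat.log b k = n} ≃ Finset.Ico (b ^ n) (b ^ (n + 1)) where
  toFun k := ⟨k.1.1, Finset.mem_Ico.2
    ((Nat.log_eq_iff (Or.inr ⟨hb, k.1.2.ne'⟩)).1 k.2)⟩
  invFun k :=
    have hk : 0 < k.1 := (pow_pos (by omega) n).trans_le (Finset.mem_Ico.1 k.2).1
    ⟨⟨k.1, hk⟩, (Nat.log_eq_iff (Or.inr ⟨hb, hk.ne'⟩)).2 (Finset.mem_Ico.1 k.2)⟩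
  left_inv _ := rfl
  right_inv _ := rfl

theorem mu1_mul_pow {b k : ℕ} (hb : 2 ≤ b) (hk : 0 < k) (m : ℕ) :
    mu1 b (k * b ^ m) = Nat.log b k + 1 + m := by
  have hpos : k * b ^ m ≠ 0 := (Nat.mul_pos hk (pow_pos (by omega) m)).ne'
  have hlog : Nat.log b (k * b ^ m) = Nat.log b k + m := by
    induction m with
    | zero => simp
    | succ m ih =>
      have hm : k * b ^ m ≠ 0 := (Nat.mul_pos hk (pow_pos (by omega) m)).ne'
      rw [pow_succ, ← mul_assoc, Nat.log_mul_base hb hm, ih hm, add_assoc]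
  rw [mu1, if_neg hpos, hlog]
  omega

/-- The geometric sum over digit lengths of positive integers, for a ratio `r < 1 / b`. -/
theorem hasSum_pow_log_succ {b : ℕ} (hb : 2 ≤ b) {r : ℝ} (hr : 0 ≤ r) (hbr : b * r < 1) :
    HasSum (fun k : {k : ℕ // 0 < k} => r ^ (Nat.log b k + 1))
      ((b - 1) * r * (1 - b * r)⁻¹) := by
  refine hasSum_comp_of_hasSum_card_fiber (f := fun k : {k : ℕ // 0 < k} => Nat.log b k)
    (g := fun n => r ^ (n + 1)) (fun n => pow_nonneg hr _)
    (fun n => Finite.of_equiv _ (logFiberEquiv hb n).symm) ?_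
  refine ((hasSum_geometric_of_lt_one (by positivity) hbr).mul_left _).congr_fun ?_
  intro n
  have hle : b ^ n ≤ b ^ (n + 1) := Nat.pow_le_pow_right (by omega) n.le_succ
  rw [Nat.card_congr (logFiberEquiv hb n), Nat.card_eq_fintype_card, Fintype.card_coe,
    Nat.card_Ico, Nat.cast_sub hle]
  push_cast
  ring

/-- **Geometric digit sum over multiples of `b^m`.** For an integer base
`b ≥ 2`, `m ≥ 1` and a real `c > 1`,
`∑_{k=1}^∞ b^{-c·μ₁(k·b^m)} = b^{-cm}·(b-1)/(b^c - b)`; equivalently this is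
the sum of `b^{-c μ₁(ℓ)}` over positive multiples `ℓ` of `b^m`. -/
theorem tsum_digit_count_multiples (b : ℕ) (hb : 2 ≤ b) (m : ℕ) (hm : 1 ≤ m)
    (c : ℝ) (hc : 1 < c) :
    (∑' k : {k : ℕ // 0 < k}, (b : ℝ) ^ (-(c * (mu1 b (k.1 * b ^ m) : ℝ)))) =
      (b : ℝ) ^ (-(c * (m : ℝ))) *
        (((b : ℝ) - 1) / ((b : ℝ) ^ c - (b : ℝ))) := by
  have hb0 : (0 : ℝ) < b := by positivity
  have hb1 : (1 : ℝ) < b := by exact_mod_cast hb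
  have hlt : (b : ℝ) < (b : ℝ) ^ c := by
    simpa using Real.rpow_lt_rpow_of_exponent_lt hb1 hc
  have hc0 : (0 : ℝ) < (b : ℝ) ^ c := Real.rpow_pos_of_pos hb0 c
  have hbr : (b : ℝ) * (b : ℝ) ^ (-c) < 1 := by
    rwa [Real.rpow_neg hb0.le, ← div_eq_mul_inv, div_lt_one hc0]
  have hterm (k : {k : ℕ // 0 < k}) : (b : ℝ) ^ (-(c * (mu1 b (k.1 * b ^ m) : ℝ))) =
      (b : ℝ) ^ (-(c * (m : ℝ))) * ((b : ℝ) ^ (-c)) ^ (Nat.log b k + 1) := by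
    rw [mu1_mul_pow hb k.2, ← Real.rpow_mul_natCast hb0.le, ← Real.rpow_add hb0]
    congr 1
    push_cast
    ring
  simp_rw [hterm]
  rw [tsum_mul_left, (hasSum_pow_log_succ hb (Real.rpow_nonneg hb0.le _) hbr).tsum_eq,
    Real.rpow_neg hb0.le c]
  have hsub : (b : ℝ) ^ c - b ≠ 0 := (sub_pos.2 hlt).ne'
  have hinv : 1 - (b : ℝ) * ((b : ℝ) ^ c)⁻¹ = ((b : ℝ) ^ c - b) / (b : ℝ) ^ c := by
    field_simp
  rw [hinv]
  field_simp
end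

section
/- Let b ≥ 2 and α ≥ 1 be integers. For any nonnegative integers z₁, …, z_α, the inequality μ_α(E_α(z₁, …, z_α)) ≥ α · Σ_{j=1}^α μ₁(z_j) − α(α−1)/2 holds. -/
/-- The set of positions `a ≥ 1` such that the base-`b` digit of `k` at
position `a` (i.e. the coefficient of `b^(a-1)`) is nonzero. -/
def digitPositions (b k : ℕ) : Finset ℕ :=
  (Finset.range (k + 2)).filter fun a => 0 < a ∧ k / b ^ (a - 1) % b ≠ 0

/-- `muAlpha b α k` is the sum of the positions of the `min(α, ρ)` most
significant nonzero base-`b` digits of `k`, where `ρ` is the number of nonzero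
digits of `k`: the sum of those nonzero-digit positions having fewer than `α`
larger nonzero-digit positions. -/
def muAlpha (b α k : ℕ) : ℕ :=
  ∑ a ∈ (digitPositions b k).filter
    (fun a => ((digitPositions b k).filter fun a' => a < a').card < α), a

/-- The digit interlacing function `E_α`:
`E_α(ℓ₁,…,ℓ_α) = ∑_{a≥0} ∑_{j=1}^α l_{j,a} b^{j-1+aα}` where
`ℓ_j = ∑_a l_{j,a} b^a` is the base-`b` expansion. -/
def interlace (b α : ℕ) (z : Fin α → ℕ) : ℕ :=
  ∑ j : Fin α, ∑ a ∈ Finset.range (z j + 1), (z j / b ^ a % b) * b ^ (j.1 + a * α)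

/-- The sum of the at most `n` largest elements of `P` bounds the sum of every subset of `P` with
at most `n` elements. -/
theorem sum_le_sum_filter_card_lt (P : Finset ℕ) :
    ∀ (n : ℕ) (T : Finset ℕ), T ⊆ P → T.card ≤ n →
      ∑ a ∈ T, a ≤ ∑ a ∈ P.filter (fun a => (P.filter fun a' => a < a').card < n), a := by
  induction P using Finset.induction_on_max with
  | empty =>
    intro n T hT _
    simp [Finset.subset_empty.mp hT]
  | insert m P hm ih =>
    intro n T hT hcard
    have hmP : m ∉ P := fun h => lt_irrefl _ (hm m h)
    rcases T.eq_empty_or_nonempty with rfl | hne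
    · simp
    obtain ⟨n, rfl⟩ : ∃ k, n = k + 1 :=
      ⟨n - 1, by have := hne.card_pos; omega⟩
    have htop : (insert m P).filter
          (fun a => ((insert m P).filter fun a' => a < a').card < n + 1) =
        insert m (P.filter fun a => (P.filter fun a' => a < a').card < n) := by
      have h1 : (P.filter fun a' => m < a') = ∅ := by
        ext x
        simp only [Finset.mem_filter, Finset.notMem_empty, iff_false, not_and, not_lt]
        exact fun hx => (hm x hx).le
      rw [Finset.filter_insert, if_pos]
      · congr 1
        refine Finset.filter_congr fun a ha => ?_
        rw [Finset.filter_insert, if_pos (hm a ha), Finset.card_insert_of_notMem (by simp [hmP])]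
        omega
      · simp [Finset.filter_insert, h1]
    rw [htop, Finset.sum_insert (by simp [hmP])]
    obtain ⟨t, htT, htm, hsub⟩ : ∃ t ∈ T, t ≤ m ∧ T.erase t ⊆ P := by
      by_cases hmT : m ∈ T
      · exact ⟨m, hmT, le_rfl, Finset.subset_insert_iff.mp hT⟩
      · have hTP : T ⊆ P := (Finset.subset_insert_iff_of_notMem hmT).mp hT
        obtain ⟨t, ht⟩ := hne
        exact ⟨t, ht, (hm t (hTP ht)).le, (Finset.erase_subset _ _).trans hTP⟩
    rw [← Finset.add_sum_erase T (fun a => a) htT]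
    refine add_le_add htm (ih n _ hsub ?_)
    rw [Finset.card_erase_of_mem htT]
    omega

/-- The base-`b` digits of `∑ i < N, d i * b ^ i` are the `d i`, provided these are below `b`. -/
theorem sum_mul_pow_div_pow_mod {b : ℕ} (hb : 0 < b) (N : ℕ) :
    ∀ (d : ℕ → ℕ), (∀ i, d i < b) → ∀ k < N,
      (∑ i ∈ Finset.range N, d i * b ^ i) / b ^ k % b = d k := by
  induction N with
  | zero => intro d _ k hk; omega
  | succ N ih =>
    intro d hd k hk
    have hsplit : ∑ i ∈ Finset.range (N + 1), d i * b ^ i =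
        d 0 + b * ∑ i ∈ Finset.range N, d (i + 1) * b ^ i := by
      rw [Finset.sum_range_succ', Finset.mul_sum, add_comm]
      congr 1
      · simp
      · exact Finset.sum_congr rfl fun i _ => by ring
    rw [hsplit]
    cases k with
    | zero => simp [Nat.mod_eq_of_lt (hd 0)]
    | succ k =>
      rw [pow_succ', ← Nat.div_div_eq_div_mul, Nat.add_mul_div_left _ _ hb,
        Nat.div_eq_of_lt (hd 0), zero_add]
      exact ih (fun i => d (i + 1)) (fun i => hd _) k (by omega)

/-- The base-`b` digits of the interlaced number are those of its components. -/
theorem interlace_div_pow_mod {b : ℕ} (hb : 2 ≤ b) {α : ℕ} (z : Fin α → ℕ) (j : Fin α) (a : ℕ) :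
    interlace b α z / b ^ (j.1 + a * α) % b = z j / b ^ a % b := by
  have hα : 0 < α := j.pos
  let d : ℕ → ℕ := fun i => z ⟨i % α, Nat.mod_lt _ hα⟩ / b ^ (i / α) % b
  have hd (i : Fin α) (c : ℕ) : d (i.1 + c * α) = z i / b ^ c % b := by
    simp only [d, Nat.add_mul_mod_self_right, Nat.add_mul_div_right _ _ hα,
      Nat.mod_eq_of_lt i.2, Nat.div_eq_of_lt i.2, zero_add]
  let M := ∑ i, (z i + 1) + a + 1
  have hM : interlace b α z = ∑ i ∈ Finset.range (M * α), d i * b ^ i := by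
    rw [Finset.sum_range, ← finProdFinEquiv.sum_comp, Fintype.sum_prod_type_right, interlace]
    refine Finset.sum_congr rfl fun i _ => ?_
    have hi : z i + 1 ≤ M := by
      have := Finset.single_le_sum (f := fun i => z i + 1) (fun _ _ => Nat.zero_le _)
        (Finset.mem_univ i)
      simp only [M]
      omega
    rw [Finset.sum_subset (Finset.range_mono hi), Finset.sum_range]
    · refine Finset.sum_congr rfl fun c _ => ?_
      simp only [finProdFinEquiv_apply_val, mul_comm α, hd]
    · intro c _ hc
      have hzc : z i < b ^ c := by
        have h1 : c < b ^ c := Nat.lt_pow_self hb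
        simp only [Finset.mem_range] at hc
        omega
      simp [Nat.div_eq_of_lt hzc]
  rw [hM, sum_mul_pow_div_pow_mod (by omega) _ d (fun i => Nat.mod_lt _ (by omega)), hd]
  have h1 : (a + 1) * α ≤ M * α := Nat.mul_le_mul_right _ (by simp only [M]; omega)
  have h2 := j.2
  linarith

theorem mem_digitPositions {b : ℕ} (hb : 2 ≤ b) {k e : ℕ} (h : k / b ^ e % b ≠ 0) :
    e + 1 ∈ digitPositions b k := by
  have hk : b ^ e ≤ k := by
    by_contra! hlt
    simp [Nat.div_eq_of_lt hlt] at h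
  have he : e < b ^ e := Nat.lt_pow_self hb
  simp only [digitPositions, Finset.mem_filter, Finset.mem_range, Nat.add_sub_cancel]
  exact ⟨by omega, by omega, h⟩

theorem div_pow_log_mod_ne_zero {b : ℕ} (hb : 2 ≤ b) {k : ℕ} (hk : k ≠ 0) :
    k / b ^ Nat.log b k % b ≠ 0 := by
  have hlt : k / b ^ Nat.log b k < b := by
    rw [Nat.div_lt_iff_lt_mul (by positivity), ← pow_succ']
    exact Nat.lt_pow_succ_log_self hb k
  rw [Nat.mod_eq_of_lt hlt]
  exact (Nat.div_pos (Nat.pow_log_le_self b hk) (by positivity)).ne'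

/-- **Interlacing lower bound:**
`μ_α(E_α(z₁,…,z_α)) ≥ α·∑_{j=1}^α μ₁(z_j) − α(α−1)/2`. -/
theorem muAlpha_interlace_ge (b : ℕ) (hb : 2 ≤ b) (α : ℕ) (hα : 1 ≤ α)
    (z : Fin α → ℕ) :
    (α : ℤ) * ∑ j, (mu1 b (z j) : ℤ) - (α : ℤ) * ((α : ℤ) - 1) / 2 ≤
      (muAlpha b α (interlace b α z) : ℤ) := by
  let p : Fin α → ℕ := fun j => j.1 + Nat.log b (z j) * α + 1
  let J : Finset (Fin α) := Finset.univ.filter fun j => z j ≠ 0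
  have hinj : Function.Injective p := by
    intro i j hij
    have h : (i.1 + Nat.log b (z i) * α) % α = (j.1 + Nat.log b (z j) * α) % α :=
      congrArg (· % α) (Nat.succ.inj hij)
    rw [Nat.add_mul_mod_self_right, Nat.add_mul_mod_self_right, Nat.mod_eq_of_lt i.2,
      Nat.mod_eq_of_lt j.2] at h
    exact Fin.ext h
  have hlead : ∑ j ∈ J, p j ≤ muAlpha b α (interlace b α z) := by
    rw [← Finset.sum_image (g := p) (f := fun a => a) hinj.injOn]
    refine sum_le_sum_filter_card_lt _ α _ ?_ ?_
    · intro a ha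
      obtain ⟨j, hj, rfl⟩ := Finset.mem_image.mp ha
      refine mem_digitPositions hb ?_
      rw [interlace_div_pow_mod hb]
      exact div_pow_log_mod_ne_zero hb (Finset.mem_filter.mp hj).2
    · exact Finset.card_image_le.trans ((Finset.card_le_univ J).trans (by simp))
  have hgap : ∑ j : Fin α, (α - 1 - j.1) = α * (α - 1) / 2 := by
    rw [Fin.sum_univ_eq_sum_range (fun i => α - 1 - i),
      Finset.sum_range_reflect (fun i => i), Finset.sum_range_id]
  have hsum : α * ∑ j, mu1 b (z j) ≤ ∑ j ∈ J, p j + α * (α - 1) / 2 := by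
    rw [← hgap, Finset.sum_filter, Finset.mul_sum, ← Finset.sum_add_distrib]
    refine Finset.sum_le_sum fun j _ => ?_
    by_cases hj : z j = 0
    · simp [mu1, hj]
    · have hjα := j.2
      rw [if_pos hj, mu1, if_neg hj, mul_add, mul_one, mul_comm α]
      simp only [p]
      omega
  have hcast : ((α * (α - 1) / 2 : ℕ) : ℤ) = (α : ℤ) * ((α : ℤ) - 1) / 2 := by
    push_cast [Nat.cast_sub hα]
    rfl
  have := hsum.trans (Nat.add_le_add_right hlead _)
  rw [← hcast]
  zify at this ⊢
  linarith
end

section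
/- Let α, s ≥ 1 be integers, 0 < λ ≤ 1, and let (β̃_j)_{j≥1} be nonnegative real numbers. Define d_j := β̃_{⌈j/α⌉} for j ≥ 1. Then Σ over all nonzero ν ∈ {0,1,…,α}^s of (|ν|! · ∏_{j=1}^s β̃_j^{ν_j})^λ is at most Σ_{ℓ=1}^∞ (ℓ!)^{λ−1} · (Σ_{j=1}^∞ d_j^λ)^ℓ, where |ν| = Σ_{j=1}^s ν_j (the right-hand side may be +∞). -/
open scoped ENNReal

theorem Nat.factorial_sum_le_multinomial_mul_pow {ι : Type*} (t : Finset ι) (ν : ι → ℕ) (α : ℕ)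
    (hν : ∀ i ∈ t, ν i ≤ α) :
    (∑ i ∈ t, ν i).factorial ≤ Nat.multinomial t ν * α ^ ∑ i ∈ t, ν i := by
  rw [← Nat.multinomial_spec t ν, mul_comm, ← Finset.prod_pow_eq_pow_sum]
  refine Nat.mul_le_mul_left _ (Finset.prod_le_prod' fun i hi ↦ ?_)
  exact (Nat.factorial_le_pow (ν i)).trans (Nat.pow_le_pow_left (hν i hi) _)

/-- The multi-indices of total degree `n` with entries at most `α` contribute at most the
`n`-th power of the sum in which every variable is repeated `α` times. -/
theorem sum_factorial_mul_prod_pow_le {ι : Type*} [Fintype ι] [DecidableEq ι] (α n : ℕ)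
    (a : ι → ℝ) (ha : ∀ i, 0 ≤ a i) :
    ∑ ν : ι → Fin (α + 1) with ∑ i, (ν i : ℕ) = n,
        ((n.factorial : ℝ) * ∏ i, a i ^ (ν i : ℕ)) ≤ (∑ i, α * a i) ^ n := by
  rw [Finset.sum_pow_eq_sum_piAntidiag]
  let e : (ι → Fin (α + 1)) ↪ (ι → ℕ) :=
    ⟨fun ν i ↦ ν i, fun ν μ h ↦ funext fun i ↦ Fin.ext (congrFun h i)⟩
  have hsub : ({ν : ι → Fin (α + 1) | ∑ i, (ν i : ℕ) = n} : Finset _).map e ⊆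
      Finset.piAntidiag Finset.univ n := by
    intro k hk
    obtain ⟨ν, hν, rfl⟩ := Finset.mem_map.1 hk
    exact Finset.mem_piAntidiag.2 ⟨(Finset.mem_filter.1 hν).2, fun i _ ↦ Finset.mem_univ i⟩
  refine le_trans ?_ (Finset.sum_le_sum_of_subset_of_nonneg hsub fun k _ _ ↦ ?_)
  · rw [Finset.sum_map]
    refine Finset.sum_le_sum fun ν hν ↦ ?_
    have hn : ∑ i, (ν i : ℕ) = n := (Finset.mem_filter.1 hν).2
    have h := Nat.factorial_sum_le_multinomial_mul_pow Finset.univ (fun i ↦ (ν i : ℕ)) α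
      fun i _ ↦ Nat.lt_succ_iff.1 (ν i).2
    rw [hn] at h
    have h' : (n.factorial : ℝ) ≤ Nat.multinomial Finset.univ (e ν) * (α : ℝ) ^ n := by
      exact_mod_cast h
    have hp : ∏ i, (α * a i) ^ e ν i = (α : ℝ) ^ n * ∏ i, a i ^ (ν i : ℕ) := by
      simp only [mul_pow, Finset.prod_mul_distrib, Finset.prod_pow_eq_pow_sum]
      rw [← hn]
      rfl
    rw [hp, ← mul_assoc]
    exact mul_le_mul_of_nonneg_right h' (Finset.prod_nonneg fun i _ ↦ pow_nonneg (ha i) _)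
  · exact mul_nonneg (Nat.cast_nonneg _) (Finset.prod_nonneg fun i _ ↦
      pow_nonneg (mul_nonneg (Nat.cast_nonneg _) (ha i)) _)

theorem ofReal_sum_mul_le_tsum_div (α s : ℕ) (a : ℕ → ℝ) (ha : ∀ j, 0 ≤ a j) :
    ENNReal.ofReal (∑ i : Fin s, α * a i) ≤ ∑' j : ℕ, ENNReal.ofReal (a (j / α)) := by
  have hinj : Function.Injective fun p : Fin s × Fin α ↦ (finProdFinEquiv p : ℕ) :=
    Fin.val_injective.comp finProdFinEquiv.injective
  refine le_trans (le_of_eq ?_) (ENNReal.tsum_comp_le_tsum_of_injective hinj _)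
  rw [tsum_fintype, Fintype.sum_prod_type,
    ENNReal.ofReal_sum_of_nonneg fun i _ ↦ mul_nonneg α.cast_nonneg (ha i.1)]
  refine Finset.sum_congr rfl fun i _ ↦ ?_
  have h (k : Fin α) : (finProdFinEquiv (i, k) : ℕ) / α = i := by
    rw [finProdFinEquiv_apply_val, Nat.add_mul_div_left _ _ (Nat.zero_lt_of_lt k.2),
      Nat.div_eq_of_lt k.2, zero_add]
  simp only [h]
  simp [ENNReal.ofReal_mul]

theorem factorial_mul_prod_rpow_eq {ι : Type*} [Fintype ι] (n : ℕ) (l : ℝ) (b : ι → ℝ)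
    (hb : ∀ i, 0 ≤ b i) (ν : ι → ℕ) :
    ((n.factorial : ℝ) * ∏ i, b i ^ ν i) ^ l =
      (n.factorial : ℝ) ^ (l - 1) * (n.factorial * ∏ i, (b i ^ l) ^ ν i) := by
  have hn : (0 : ℝ) < n.factorial := by exact_mod_cast n.factorial_pos
  rw [Real.mul_rpow hn.le (Finset.prod_nonneg fun i _ ↦ pow_nonneg (hb i) _),
    ← Real.finsetProd_rpow _ _ fun i _ ↦ pow_nonneg (hb i) _, ← mul_assoc,
    Real.rpow_sub_one hn.ne', div_mul_cancel₀ _ hn.ne']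
  congr 1
  refine Finset.prod_congr rfl fun i _ ↦ ?_
  rw [← Real.rpow_natCast, ← Real.rpow_natCast, ← Real.rpow_mul (hb i), ← Real.rpow_mul (hb i),
    mul_comm]

/-- **Multi-index sum bound.** For integers `α, s ≥ 1`, `0 < λ ≤ 1` and
nonnegative reals `β̃` (here `βt j` is the paper's `β̃_{j+1}`), with the
repeated sequence `d_j := β̃_{⌈j/α⌉}` (`0`-indexed: `d j = βt (j / α)`),
the sum over all nonzero `ν ∈ {0,…,α}^s` of `(|ν|!·∏_j β̃_j^{ν_j})^λ`
is at most `∑_{ℓ=1}^∞ (ℓ!)^{λ-1} (∑_j d_j^λ)^ℓ` (possibly `+∞`, hence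
the statement is phrased in `ℝ≥0∞`). -/
theorem multiindex_sum_le (α s : ℕ) (hα : 1 ≤ α) (hs : 1 ≤ s)
    (l : ℝ) (hl0 : 0 < l) (hl1 : l ≤ 1)
    (βt : ℕ → ℝ) (hβt : ∀ j, 0 ≤ βt j) :
    ENNReal.ofReal
        (∑ ν ∈ (Finset.univ : Finset (Fin s → Fin (α + 1))).filter (· ≠ 0),
          (((∑ j : Fin s, ((ν j : ℕ))).factorial : ℝ) *
              ∏ j : Fin s, βt j.1 ^ ((ν j : ℕ))) ^ l) ≤
      ∑' ℓ : ℕ,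
        ENNReal.ofReal (((ℓ + 1).factorial : ℝ) ^ (l - 1)) *
          (∑' j : ℕ, ENNReal.ofReal (βt (j / α) ^ l)) ^ (ℓ + 1) := by
  have ha (j : ℕ) : 0 ≤ βt j ^ l := Real.rpow_nonneg (hβt j) l
  have hpos : ∀ ν ∈ (Finset.univ : Finset (Fin s → Fin (α + 1))).filter (· ≠ 0),
      ∑ j, (ν j : ℕ) ≠ 0 := fun ν hν h ↦ (Finset.mem_filter.1 hν).2 <| funext fun j ↦
    Fin.ext (Finset.sum_eq_zero_iff.1 h j (Finset.mem_univ j))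
  have hmaps : ∀ ν ∈ (Finset.univ : Finset (Fin s → Fin (α + 1))).filter (· ≠ 0),
      (∑ j, (ν j : ℕ)) - 1 ∈ Finset.range (s * α) := by
    intro ν hν
    have hne := hpos ν hν
    have hle : ∑ j, (ν j : ℕ) ≤ s * α := by
      simpa using Finset.sum_le_card_nsmul Finset.univ (fun j ↦ (ν j : ℕ)) α
        fun j _ ↦ Nat.lt_succ_iff.1 (ν j).2
    rw [Finset.mem_range]
    omega
  rw [← Finset.sum_fiberwise_of_maps_to hmaps, ENNReal.ofReal_sum_of_nonneg]
  · refine le_trans (Finset.sum_le_sum fun n _ ↦ ?_) (ENNReal.sum_le_tsum (Finset.range (s * α)))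
    have hfac : (0 : ℝ) ≤ ((n + 1).factorial : ℝ) ^ (l - 1) :=
      Real.rpow_nonneg (Nat.cast_nonneg _) _
    refine le_trans (ENNReal.ofReal_le_ofReal (?_ : _ ≤ ((n + 1).factorial : ℝ) ^ (l - 1) *
      (∑ i : Fin s, α * βt i ^ l) ^ (n + 1))) ?_
    · refine le_trans ?_ (mul_le_mul_of_nonneg_left
        (sum_factorial_mul_prod_pow_le α (n + 1) (fun i : Fin s ↦ βt i ^ l) fun i ↦ ha i) hfac)
      rw [Finset.mul_sum]
      have hdeg : ∀ ν ∈ {ν ∈ (Finset.univ : Finset (Fin s → Fin (α + 1))).filter (· ≠ 0) |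
          (∑ j, (ν j : ℕ)) - 1 = n}, ∑ j, (ν j : ℕ) = n + 1 := by
        intro ν hν
        obtain ⟨hν0, hνn⟩ := Finset.mem_filter.1 hν
        have hne := hpos ν hν0
        omega
      rw [Finset.sum_congr rfl fun ν hν ↦ by
        rw [hdeg ν hν, factorial_mul_prod_rpow_eq (n + 1) l (fun j : Fin s ↦ βt j)
          (fun j ↦ hβt j) fun j ↦ (ν j : ℕ)]]
      refine Finset.sum_le_sum_of_subset_of_nonneg (fun ν hν ↦ ?_) fun ν _ _ ↦ ?_
      · exact Finset.mem_filter.2 ⟨Finset.mem_univ ν, hdeg ν hν⟩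
      · exact mul_nonneg hfac (mul_nonneg (Nat.cast_nonneg _)
          (Finset.prod_nonneg fun i _ ↦ pow_nonneg (ha i) _))
    · rw [ENNReal.ofReal_mul hfac, ENNReal.ofReal_pow (Finset.sum_nonneg fun i _ ↦
        mul_nonneg α.cast_nonneg (ha i.1))]
      gcongr
      exact ofReal_sum_mul_le_tsum_div α s (fun j ↦ βt j ^ l) ha
  · exact fun n _ ↦ Finset.sum_nonneg fun ν _ ↦ Real.rpow_nonneg (mul_nonneg (Nat.cast_nonneg _)
      (Finset.prod_nonneg fun i _ ↦ pow_nonneg (hβt i.1) _)) _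
end

section
/- Let 0 < p < 1, let (β_j)_{j≥1} be nonnegative reals with Σ_{j≥1} β_j^p < ∞, let b be a prime, and set α := ⌊1/p⌋ + 1. Then there exists a constant C < ∞, depending only on α, (β_j), b and p, with the following property: for every integer s ≥ 1 and every integer m ≥ 1 with N := b^m, there exist points y₀, …, y_{N−1} ∈ [0,1]^s such that for every constant c > 0 and every function F : [0,1]^s → ℝ possessing continuous partial derivatives of order up to α in each variable and satisfying |(∂_y^ν F)(y)| ≤ c · |ν|! · ∏_{j=1}^s β_j^{ν_j} for all y ∈ [0,1]^s and all multi-indices ν ∈ {0,1,…,α}^s, the quadrature error satisfies | (1/N)·Σ_{n=0}^{N−1} F(y_n) − ∫_{[0,1]^s} F(y) dy | ≤ c · C · N^{−1/p}. -/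
open MeasureTheory

theorem AddChar.map_finset_sum_eq_prod {A M ι : Type*} [AddCommMonoid A] [CommMonoid M]
    (ψ : AddChar A M) (s : Finset ι) (f : ι → A) : ψ (∑ i ∈ s, f i) = ∏ i ∈ s, ψ (f i) := by
  classical
  induction s using Finset.induction_on with
  | empty => simp
  | insert a s ha ih => rw [Finset.sum_insert ha, Finset.prod_insert ha, map_add_eq_mul, ih]

open Matrix in
theorem sum_stdAddChar_dotProduct {b : ℕ} [NeZero b] {ι : Type*} [Fintype ι] [DecidableEq ι]
    (u : ι → ZMod b) :
    ∑ x : ι → ZMod b, (ZMod.stdAddChar (x ⬝ᵥ u) : ℂ) =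
      if u = 0 then (b : ℂ) ^ Fintype.card ι else 0 := by
  simp only [dotProduct, AddChar.map_finset_sum_eq_prod]
  rw [← Fintype.prod_sum (fun i (t : ZMod b) => (ZMod.stdAddChar (t * u i) : ℂ))]
  simp only [AddChar.sum_mulShift _ (ZMod.isPrimitive_stdAddChar b), ZMod.card]
  split_ifs with h
  · simp [h]
  · obtain ⟨i, hi⟩ := Function.ne_iff.1 h
    exact Finset.prod_eq_zero (Finset.mem_univ i) (by rw [if_neg (by simpa using hi), Nat.cast_zero])

open Matrix in
/-- Unnormalised Walsh coefficient of a function of finitely many base `b` digits. -/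
noncomputable def walshSum {b : ℕ} {ι : Type*} [Fintype ι] [DecidableEq ι] [NeZero b]
    (g : (ι → ZMod b) → ℂ) (k : ι → ZMod b) : ℂ :=
  ∑ x, g x * ZMod.stdAddChar (-(k ⬝ᵥ x))

open Matrix in
theorem walsh_inversion {b : ℕ} [NeZero b] {ι : Type*} [Fintype ι] [DecidableEq ι]
    (g : (ι → ZMod b) → ℂ) (y : ι → ZMod b) :
    (b : ℂ) ^ Fintype.card ι * g y = ∑ k, walshSum g k * ZMod.stdAddChar (k ⬝ᵥ y) := by
  have h (k x : ι → ZMod b) : g x * (ZMod.stdAddChar (-(k ⬝ᵥ x)) : ℂ) * ZMod.stdAddChar (k ⬝ᵥ y) =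
      g x * ZMod.stdAddChar (k ⬝ᵥ (y - x)) := by
    rw [mul_assoc, ← AddChar.map_add_eq_mul, dotProduct_sub]
    ring_nf
  simp only [walshSum, Finset.sum_mul, h]
  rw [Finset.sum_comm]
  simp only [← Finset.mul_sum, sum_stdAddChar_dotProduct, sub_eq_zero]
  simp [mul_comm]

open Matrix in
/-- The error of a digital net is the sum of the Walsh coefficients over the nonzero elements of
its dual net. -/
theorem digitalNet_error {b : ℕ} [NeZero b] {ι : Type*} [Fintype ι] [DecidableEq ι] {m : ℕ}
    (g : (ι → ZMod b) → ℂ) (M : Matrix ι (Fin m) (ZMod b)) :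
    (b : ℂ) ^ Fintype.card ι * ((∑ v, g (M *ᵥ v)) / (b : ℂ) ^ m) - ∑ x, g x =
      ∑ k with k ≠ 0 ∧ k ᵥ* M = 0, walshSum g k := by
  have hb : (b : ℂ) ≠ 0 := Nat.cast_ne_zero.2 (NeZero.ne b)
  have h1 : (b : ℂ) ^ Fintype.card ι * ∑ v, g (M *ᵥ v) =
      (b : ℂ) ^ m * ∑ k with k ᵥ* M = 0, walshSum g k := by
    simp only [Finset.mul_sum, walsh_inversion]
    rw [Finset.sum_comm]
    have (k : ι → ZMod b) : ∑ v : Fin m → ZMod b, walshSum g k * ZMod.stdAddChar (k ⬝ᵥ (M *ᵥ v)) =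
        if k ᵥ* M = 0 then (b : ℂ) ^ m * walshSum g k else 0 := by
      simp only [dotProduct_mulVec, ← Finset.mul_sum]
      simp only [dotProduct_comm (k ᵥ* M), sum_stdAddChar_dotProduct]
      simp [mul_comm]
    simp only [this, Finset.sum_filter]
  have h2 : ∑ k with k ᵥ* M = 0, walshSum g k =
      walshSum g 0 + ∑ k with k ≠ 0 ∧ k ᵥ* M = 0, walshSum g k := by
    rw [← Finset.add_sum_erase _ _ (a := 0) (by simp)]
    congr 2
    ext k
    simp
  have h3 : walshSum g 0 = ∑ x, g x := by simp [walshSum]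
  rw [mul_div_assoc', h1, h2, h3]
  field_simp
  ring

open Matrix in
theorem card_filter_vecMul_eq_zero {b : ℕ} [Fact b.Prime] {ι : Type*} [Fintype ι] [DecidableEq ι]
    (m : ℕ) {k : ι → ZMod b} (hk : k ≠ 0) :
    (b : ℝ) ^ m * (Finset.univ.filter fun M : Matrix ι (Fin m) (ZMod b) => k ᵥ* M = 0).card =
      Fintype.card (Matrix ι (Fin m) (ZMod b)) := by
  let f : Matrix ι (Fin m) (ZMod b) →+ (Fin m → ZMod b) :=
    { toFun := fun M => k ᵥ* M
      map_zero' := vecMul_zero k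
      map_add' := fun A B => vecMul_add A B k }
  have hf : Function.Surjective f := fun w => by
    obtain ⟨i, hi⟩ := Function.ne_iff.1 hk
    refine ⟨Matrix.of fun j l => if j = i then (k i)⁻¹ * w l else 0, ?_⟩
    ext l
    simp only [f, AddMonoidHom.coe_mk, ZeroHom.coe_mk, vecMul, dotProduct, of_apply, mul_ite,
      mul_zero, Finset.sum_ite_eq', Finset.mem_univ, if_true]
    exact mul_inv_cancel_left₀ hi _
  have h := Finset.card_eq_sum_card_fiberwise (f := f) (s := Finset.univ) (t := Finset.univ)
    (by simp)
  rw [Finset.sum_congr rfl fun w _ =>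
    AddMonoidHom.card_fiber_eq_of_mem_range f (hf w) (hf 0)] at h
  rw [← Finset.card_univ, h]
  simp [f, ZMod.card]

open Matrix in
/-- Averaging over all generating matrices yields a digital net with small weighted dual sum. -/
theorem exists_matrix_dual_sum_le {b : ℕ} [Fact b.Prime] {ι : Type*} [Fintype ι] [DecidableEq ι]
    (m : ℕ) (w : (ι → ZMod b) → ℝ) (hw : ∀ k, 0 ≤ w k) :
    ∃ M : Matrix ι (Fin m) (ZMod b),
      ∑ k with k ≠ 0 ∧ k ᵥ* M = 0, w k ≤ (∑ k, w k) / (b : ℝ) ^ m := by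
  have hb : (0 : ℝ) < (b : ℝ) ^ m := pow_pos (Nat.cast_pos.2 (Fact.out : b.Prime).pos) m
  have key : ∑ M : Matrix ι (Fin m) (ZMod b), ∑ k with k ≠ 0 ∧ k ᵥ* M = 0, w k ≤
      ∑ M : Matrix ι (Fin m) (ZMod b), (∑ k, w k) / (b : ℝ) ^ m := by
    simp only [Finset.sum_filter]
    rw [Finset.sum_comm, Finset.sum_const, nsmul_eq_mul, Finset.card_univ, mul_div_assoc',
      Finset.mul_sum, Finset.sum_div]
    refine Finset.sum_le_sum fun k _ => ?_
    by_cases hk : k = 0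
    · simp only [hk, ne_eq, not_true_eq_false, false_and, if_false, Finset.sum_const_zero]
      exact div_nonneg (mul_nonneg (Nat.cast_nonneg _) (hw _)) hb.le
    · simp only [ne_eq, hk, not_false_eq_true, true_and]
      rw [← Finset.sum_filter, Finset.sum_const, nsmul_eq_mul, le_div_iff₀ hb,
        ← card_filter_vecMul_eq_zero m hk]
      apply le_of_eq
      ring
  obtain ⟨M, -, hM⟩ := Finset.exists_le_of_sum_le Finset.univ_nonempty key
  exact ⟨M, hM⟩

open Matrix in
theorem walshSum_eq_zero_of_invariant {b : ℕ} [NeZero b] {ι : Type*} [Fintype ι] [DecidableEq ι]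
    {h : (ι → ZMod b) → ℂ} {k : ι → ZMod b} {i : ι} (hk : k i ≠ 0)
    (hh : ∀ x x', (∀ l, l ≠ i → x l = x' l) → h x = h x') : walshSum h k = 0 := by
  have h1 : walshSum h k = walshSum h k * ZMod.stdAddChar (-(k i)) := by
    conv_lhs => rw [walshSum, ← Equiv.sum_comp (Equiv.addRight (Pi.single i 1))]
    rw [walshSum, Finset.sum_mul]
    refine Finset.sum_congr rfl fun x _ => ?_
    rw [Equiv.coe_addRight, mul_assoc, ← AddChar.map_add_eq_mul, dotProduct_add,
      dotProduct_single, mul_one, neg_add]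
    congr 1
    exact hh _ _ fun l hl => by simp [hl]
  have h2 : (ZMod.stdAddChar (-(k i)) : ℂ) ≠ 1 := fun h3 => hk <| by
    rw [← AddChar.map_zero_eq_one (ZMod.stdAddChar (N := b))] at h3
    simpa using ZMod.injective_stdAddChar h3
  by_contra h0
  exact h2 (mul_left_cancel₀ h0 (by rw [← h1, mul_one]))

/-- The point of `ℝ^s` with base `b` digits `x`, where the digit at `i` is damped by `c i`. -/
noncomputable def digitPoint {b s n : ℕ} (c : Fin s × Fin n → ℝ) (x : Fin s × Fin n → ZMod b) :
    Fin s → ℝ :=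
  fun j => ∑ a : Fin n, c (j, a) * ((x (j, a)).val : ℝ) / (b : ℝ) ^ (a.1 + 1)

theorem sum_digits_le_one {b : ℕ} (hb : 1 ≤ b) (n : ℕ) :
    ∑ a : Fin n, ((b : ℝ) - 1) / (b : ℝ) ^ (a.1 + 1) ≤ 1 := by
  have hb0 : (0 : ℝ) < b := Nat.cast_pos.2 hb
  have h : ∑ a : Fin n, ((b : ℝ) - 1) / (b : ℝ) ^ (a.1 + 1) = 1 - 1 / (b : ℝ) ^ n := by
    induction n with
    | zero => simp
    | succ n ih =>
      rw [Fin.sum_univ_castSucc]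
      simp only [Fin.val_castSucc, Fin.val_last, ih]
      field_simp
      ring
  rw [h]
  linarith [one_div_pos.2 (pow_pos hb0 n)]

theorem zmod_val_le {b : ℕ} [NeZero b] (t : ZMod b) : (t.val : ℝ) ≤ (b : ℝ) - 1 := by
  have : (t.val : ℝ) + 1 ≤ b := by exact_mod_cast ZMod.val_lt t
  linarith

theorem digitPoint_mem {b s n : ℕ} [NeZero b] {c : Fin s × Fin n → ℝ}
    (hc : ∀ i, c i ∈ Set.Icc (0 : ℝ) 1) (x : Fin s × Fin n → ZMod b) (j : Fin s) :
    digitPoint c x j ∈ Set.Icc (0 : ℝ) 1 := by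
  constructor
  · exact Finset.sum_nonneg fun a _ =>
      div_nonneg (mul_nonneg (hc _).1 (Nat.cast_nonneg _)) (by positivity)
  · refine le_trans (Finset.sum_le_sum fun a _ => ?_)
      (sum_digits_le_one (Nat.one_le_iff_ne_zero.2 (NeZero.ne b)) n)
    gcongr
    exact (mul_le_of_le_one_left (Nat.cast_nonneg _) (hc _).2).trans (zmod_val_le _)

theorem digitPoint_update {b s n : ℕ} (c : Fin s × Fin n → ℝ) (x : Fin s × Fin n → ZMod b)
    (i : Fin s × Fin n) (t : ℝ) :
    digitPoint (Function.update c i t) x = digitPoint (Function.update c i 0) x +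
      (t * (((x i).val : ℝ) / (b : ℝ) ^ (i.2.1 + 1))) • (Pi.single i.1 1 : Fin s → ℝ) := by
  obtain ⟨j, a⟩ := i
  ext l
  simp only [digitPoint, Pi.add_apply, Pi.smul_apply, smul_eq_mul]
  by_cases hl : l = j
  · subst hl
    rw [← Finset.add_sum_erase _ _ (Finset.mem_univ a), ← Finset.add_sum_erase _ _
      (Finset.mem_univ a)]
    have : ∀ u : ℝ, ∀ a' ∈ Finset.univ.erase a, Function.update c (l, a) u (l, a') *
        ((x (l, a')).val : ℝ) / (b : ℝ) ^ (a'.1 + 1) =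
        c (l, a') * ((x (l, a')).val : ℝ) / (b : ℝ) ^ (a'.1 + 1) := fun u a' ha' => by
      rw [Function.update_of_ne (by simpa using Finset.ne_of_mem_erase ha')]
    rw [Finset.sum_congr rfl (this t), Finset.sum_congr rfl (this 0)]
    simp
    ring
  · simp [hl]

/-- Decay of Walsh coefficients: every nonzero digit of `k` in `T` contributes one derivative and
a factor `b ^ (-a)`, `a` being its position. -/
theorem norm_walshSum_le {b s n A : ℕ} [NeZero b] {Fd : (Fin s → ℕ) → (Fin s → ℝ) → ℝ}
    (hder : ∀ (ν : Fin s → ℕ) (j : Fin s), (∀ i, ν i ≤ A) → ν j < A → ∀ x : Fin s → ℝ,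
      HasLineDerivAt ℝ (Fd ν) (Fd (ν + Pi.single j 1) x) x (Pi.single j 1))
    (k : Fin s × Fin n → ZMod b) {B : ℝ} (T : Finset (Fin s × Fin n)) :
    ∀ (ν : Fin s → ℕ) (c : Fin s × Fin n → ℝ) (ω : (Fin s × Fin n → ZMod b) → ℝ),
      (∀ i ∈ T, k i ≠ 0) → (∀ j, (ν + ∑ i ∈ T, Pi.single i.1 1 : Fin s → ℕ) j ≤ A) →
      (∀ x : Fin s → ℝ, (∀ i, x i ∈ Set.Icc (0 : ℝ) 1) →
        |Fd (ν + ∑ i ∈ T, Pi.single i.1 1) x| ≤ B) →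
      (∀ i, c i ∈ Set.Icc (0 : ℝ) 1) → (∀ x, |ω x| ≤ 1) →
      (∀ i ∈ T, ∀ x x', (∀ l, l ≠ i → x l = x' l) → ω x = ω x') →
      ‖walshSum (fun x => ((Fd ν (digitPoint c x) * ω x : ℝ) : ℂ)) k‖ ≤
        (b : ℝ) ^ (s * n) * ((∏ i ∈ T, ((b : ℝ) ^ i.2.1)⁻¹) * B) := by
  have hb0 : (0 : ℝ) < b := Nat.cast_pos.2 (Nat.pos_of_ne_zero (NeZero.ne b))
  induction T using Finset.induction_on with
  | empty =>
    intro ν c ω _ _ hF hc hω _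
    refine (norm_sum_le _ _).trans ?_
    calc _ ≤ ∑ x : Fin s × Fin n → ZMod b, B := by
          refine Finset.sum_le_sum fun x _ => ?_
          rw [norm_mul, AddChar.norm_apply, mul_one, Complex.norm_real, Real.norm_eq_abs, abs_mul]
          have := hF (digitPoint c x) (digitPoint_mem hc x)
          simp only [Finset.sum_empty, add_zero] at this
          exact (mul_le_of_le_one_right (abs_nonneg _) (hω x)).trans this
      _ = _ := by simp [ZMod.card]
  | insert i T hi ih =>
    intro ν c ω hk hν hF hc hω hinv
    rw [Finset.sum_insert hi, ← add_assoc] at hν hF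
    have hν' : ∀ j, ν j + (Pi.single i.1 1 : Fin s → ℕ) j ≤ A := fun j =>
      le_trans (by simp only [Pi.add_apply]; omega) (hν j)
    let D : (Fin s × Fin n → ZMod b) → ℝ := fun x => ((x i).val : ℝ) / (b : ℝ) ^ (i.2.1 + 1)
    let φ : ℝ → ℂ := fun τ => walshSum
      (fun x => ((Fd ν (digitPoint (Function.update c i (τ * c i)) x) * ω x : ℝ) : ℂ)) k
    let ω' : (Fin s × Fin n → ZMod b) → ℝ := fun x => c i * ((x i).val / b) * ω x
    let φ' : ℝ → ℂ := fun τ => ((((b : ℝ) ^ i.2.1)⁻¹ : ℝ) : ℂ) * walshSum (fun x =>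
      ((Fd (ν + Pi.single i.1 1) (digitPoint (Function.update c i (τ * c i)) x) * ω' x : ℝ) : ℂ)) k
    have hφ1 : φ 1 = walshSum (fun x => ((Fd ν (digitPoint c x) * ω x : ℝ) : ℂ)) k := by
      simp [φ]
    have hφ0 : φ 0 = 0 := by
      refine walshSum_eq_zero_of_invariant (hk i (Finset.mem_insert_self i T)) fun x x' hx => ?_
      rw [hinv i (Finset.mem_insert_self i T) x x' hx]
      simp only [zero_mul]
      suffices digitPoint (Function.update c i 0) x = digitPoint (Function.update c i 0) x' by
        rw [this]
      funext j
      refine Finset.sum_congr rfl fun a _ => ?_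
      by_cases h : (j, a) = i
      · simp [h]
      · rw [hx _ h]
    have hder' : ∀ τ, HasDerivAt φ (φ' τ) τ := by
      intro τ
      simp only [φ, φ', walshSum, Finset.mul_sum]
      refine HasDerivAt.fun_sum fun x _ => ?_
      rw [← mul_assoc]
      refine HasDerivAt.mul_const ?_ _
      rw [← Complex.ofReal_mul]
      refine HasDerivAt.ofReal_comp ?_
      have h1 := hder ν i.1 (fun j => by have := hν' j; omega)
        (by have := hν' i.1; simp at this; omega) (digitPoint (Function.update c i (τ * c i)) x)
      have h2 : HasDerivAt (fun t : ℝ => (t - τ) * (c i * D x)) (c i * D x) τ := by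
        simpa using ((hasDerivAt_id τ).sub_const τ).mul_const (c i * D x)
      have h3 := HasDerivAt.comp (h := fun t : ℝ => (t - τ) * (c i * D x)) τ
        (by simpa [HasLineDerivAt] using h1) h2
      have h4 := h3.mul_const (ω x)
      refine (h4.congr_deriv ?_).congr_of_eventuallyEq (Filter.Eventually.of_forall fun t => ?_)
      · simp only [ω', D, pow_succ]
        field_simp
      · simp only [Function.comp]
        rw [digitPoint_update c x i (t * c i), digitPoint_update c x i (τ * c i), add_assoc,
          ← add_smul]
        congr 4
        simp only [D]
        ring
    have hc' : ∀ τ ∈ Set.Icc (0 : ℝ) 1, ∀ l,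
        Function.update c i (τ * c i) l ∈ Set.Icc (0 : ℝ) 1 := fun τ hτ l => by
      by_cases h : l = i
      · subst h
        rw [Function.update_self]
        exact ⟨mul_nonneg hτ.1 (hc l).1, mul_le_one₀ hτ.2 (hc l).1 (hc l).2⟩
      · rw [Function.update_of_ne h]
        exact hc l
    have hω' : ∀ x, |ω' x| ≤ 1 := fun x => by
      have h1 : |((x i).val : ℝ) / b| ≤ 1 := by
        rw [abs_of_nonneg (by positivity)]
        exact div_le_one_of_le₀ ((zmod_val_le _).trans (by linarith)) hb0.le
      simp only [ω', abs_mul]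
      refine mul_le_one₀ (mul_le_one₀ ?_ (abs_nonneg _) h1) (abs_nonneg _) (hω x)
      rw [abs_of_nonneg (hc i).1]
      exact (hc i).2
    have bound : ∀ τ ∈ Set.Ico (0 : ℝ) 1, ‖φ' τ‖ ≤
        (b : ℝ) ^ (s * n) * ((∏ i ∈ insert i T, ((b : ℝ) ^ i.2.1)⁻¹) * B) := fun τ hτ => by
      have h := ih (ν + Pi.single i.1 1) (Function.update c i (τ * c i)) ω'
        (fun l hl => hk l (Finset.mem_insert_of_mem hl)) hν hF
        (hc' τ ⟨hτ.1, hτ.2.le⟩) hω' fun l hl x x' hx => by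
          have hli : i ≠ l := fun h => hi (h ▸ hl)
          simp only [ω', hx i hli, hinv l (Finset.mem_insert_of_mem hl) x x' hx]
      simp only [φ', norm_mul, Complex.norm_real]
      rw [Real.norm_of_nonneg (by positivity), Finset.prod_insert hi]
      calc _ ≤ ((b : ℝ) ^ i.2.1)⁻¹ * _ := mul_le_mul_of_nonneg_left h (by positivity)
        _ = _ := by ring
    have := norm_image_sub_le_of_norm_deriv_le_segment_01'
      (fun τ _ => (hder' τ).hasDerivWithinAt) bound
    rwa [hφ0, sub_zero, hφ1] at this

/-- Selecting up to `r` nonzero digits of each `κ`, preferring the finest ones, makes the weights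
summable over all `κ`, with a bound that does not deteriorate in `n` when `r = α`. -/
theorem exists_digit_selection {b α : ℕ} [NeZero b] {σ ρ : ℝ} (hσ : 1 ≤ σ) (hσb : σ ^ α = b)
    (hρ : 0 ≤ ρ) (n : ℕ) : ∀ r ≤ α, ∃ T : (Fin n → ZMod b) → Finset (Fin n),
      (∀ κ, ∀ a ∈ T κ, κ a ≠ 0) ∧ (∀ κ, (T κ).card ≤ r) ∧
      ∀ t : ℝ, 0 ≤ t → ∑ κ, ∏ a ∈ T κ, (t * ρ ^ a.1) ≤
        (σ ^ (α - r)) ^ n * ∏ a : Fin n, (1 + t * b * (σ * ρ) ^ a.1) := by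
  have hσ0 : 0 ≤ σ := zero_le_one.trans hσ
  induction n with
  | zero =>
    intro r _
    exact ⟨fun _ => ∅, by simp, by simp, by simp⟩
  | succ n ih =>
    intro r hr
    rcases Nat.eq_zero_or_pos r with rfl | hr0
    · refine ⟨fun _ => ∅, by simp, by simp, fun t ht => ?_⟩
      have h1 : 1 ≤ ∏ a : Fin (n + 1), (1 + t * b * (σ * ρ) ^ a.1) :=
        Finset.prod_induction _ (1 ≤ ·) (fun _ _ => one_le_mul_of_one_le_of_one_le) le_rfl
          fun a _ => le_add_of_nonneg_right (by positivity)
      simp only [Finset.prod_empty, Finset.sum_const, Finset.card_univ, Fintype.card_pi, ZMod.card,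
        Finset.prod_const, Fintype.card_fin, nsmul_eq_mul, mul_one, Nat.sub_zero, hσb,
        Nat.cast_pow]
      exact le_mul_of_one_le_right (by positivity) h1
    · obtain ⟨T, hT, hTc, hTs⟩ := ih r hr
      obtain ⟨T', hT', hTc', hTs'⟩ := ih (r - 1) (by omega)
      let e : Fin n ↪ Fin (n + 1) := Fin.castSuccEmb
      have he : ∀ S : Finset (Fin n), Fin.last n ∉ S.map e := fun S h => by
        obtain ⟨a, -, ha⟩ := Finset.mem_map.1 h
        exact (Fin.castSucc_lt_last a).ne ha
      refine ⟨fun κ => if κ (Fin.last n) = 0 then (T (Fin.init κ)).map e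
        else insert (Fin.last n) ((T' (Fin.init κ)).map e), fun κ a ha => ?_, fun κ => ?_,
        fun t ht => ?_⟩
      · dsimp only at ha
        split_ifs at ha with h
        · obtain ⟨a', ha', rfl⟩ := Finset.mem_map.1 ha
          exact hT _ _ ha'
        · rcases Finset.mem_insert.1 ha with rfl | ha
          · exact h
          · obtain ⟨a', ha', rfl⟩ := Finset.mem_map.1 ha
            exact hT' _ _ ha'
      · dsimp only
        split_ifs with h
        · simpa using hTc _
        · rw [Finset.card_insert_of_notMem (he _), Finset.card_map]
          have := hTc' (Fin.init κ)
          omega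
      · set P := ∏ a : Fin n, (1 + t * b * (σ * ρ) ^ a.1) with hP
        have hP0 : 0 ≤ P := Finset.prod_nonneg fun a _ => by positivity
        have step : ∀ (u : ZMod b) (κ : Fin n → ZMod b),
            (∏ a ∈ (if (Fin.snoc κ u : Fin (n + 1) → ZMod b) (Fin.last n) = 0 then
              (T (Fin.init (Fin.snoc κ u : Fin (n + 1) → ZMod b))).map e
              else insert (Fin.last n)
                ((T' (Fin.init (Fin.snoc κ u : Fin (n + 1) → ZMod b))).map e)), (t * ρ ^ a.1)) ≤
            (if u = 0 then ∏ a ∈ T κ, (t * ρ ^ a.1) else 0) +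
              t * ρ ^ n * ∏ a ∈ T' κ, (t * ρ ^ a.1) := by
          intro u κ
          simp only [Fin.snoc_last, Fin.init_snoc]
          split_ifs with h
          · rw [Finset.prod_map]
            refine le_add_of_nonneg_right (a := ∏ a ∈ T κ, (t * ρ ^ a.1)) ?_
            exact mul_nonneg (by positivity) (Finset.prod_nonneg fun a _ => by positivity)
          · rw [Finset.prod_insert (he _), Finset.prod_map, zero_add]
            rfl
        rw [← Equiv.sum_comp (Fin.snocEquiv fun _ => ZMod b), Fintype.sum_prod_type]
        have hα : σ ^ (α - (r - 1)) = σ ^ (α - r) * σ := by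
          rw [← pow_succ]
          congr 1
          omega
        calc _ ≤ ∑ u : ZMod b, ∑ κ : Fin n → ZMod b,
              ((if u = 0 then ∏ a ∈ T κ, (t * ρ ^ a.1) else 0) +
                t * ρ ^ n * ∏ a ∈ T' κ, (t * ρ ^ a.1)) :=
              Finset.sum_le_sum fun u _ => Finset.sum_le_sum fun κ _ => step u κ
          _ = (∑ κ, ∏ a ∈ T κ, (t * ρ ^ a.1)) +
                b * (t * ρ ^ n * ∑ κ, ∏ a ∈ T' κ, (t * ρ ^ a.1)) := by
              simp only [Finset.sum_add_distrib, ← Finset.mul_sum, Finset.sum_const,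
                Finset.card_univ, ZMod.card, nsmul_eq_mul]
              rw [Finset.sum_comm]
              simp
              ring
          _ ≤ (σ ^ (α - r)) ^ n * P + b * (t * ρ ^ n * ((σ ^ (α - (r - 1))) ^ n * P)) := by
              gcongr
              · exact hTs t ht
              · exact hTs' t ht
          _ = (σ ^ (α - r)) ^ n * (P * (1 + t * b * (σ * ρ) ^ n)) := by
              rw [hα]
              ring
          _ ≤ _ := by
              rw [Fin.prod_univ_castSucc]
              simp only [Fin.val_castSucc, Fin.val_last]
              rw [← hP]
              refine mul_le_mul_of_nonneg_right ?_ (by positivity)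
              exact pow_le_pow_right₀ (one_le_pow₀ hσ) (Nat.le_succ n)

theorem prod_one_add_geometric_le {θ u : ℝ} (hθ0 : 0 ≤ θ) (hθ1 : θ < 1) (hu : 0 ≤ u) (n : ℕ) :
    ∏ a : Fin n, (1 + u * θ ^ a.1) ≤ Real.exp (u * (1 - θ)⁻¹) := by
  calc _ ≤ ∏ a : Fin n, Real.exp (u * θ ^ a.1) :=
        Finset.prod_le_prod (fun a _ => by positivity) fun a _ => by
          rw [add_comm]
          exact Real.add_one_le_exp _
    _ = Real.exp (u * ∑ a ∈ Finset.range n, θ ^ a) := by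
        rw [← Real.exp_sum, Finset.mul_sum, Finset.sum_range]
    _ ≤ _ := by
        gcongr
        rw [← tsum_geometric_of_lt_one hθ0 hθ1]
        exact (summable_geometric_of_lt_one hθ0 hθ1).sum_le_tsum _ fun _ _ => by positivity

theorem summable_factorial_rpow_mul_pow {p : ℝ} (hp : p < 1) {E : ℝ} (hE : 0 < E) :
    Summable fun l : ℕ => (l.factorial : ℝ) ^ p * (E ^ l / l.factorial) := by
  refine summable_of_ratio_test_tendsto_lt_one (l := 0) zero_lt_one
    (Filter.Eventually.of_forall fun l => by positivity) ?_
  have h1 : ∀ l : ℕ, ‖((l + 1).factorial : ℝ) ^ p * (E ^ (l + 1) / (l + 1).factorial)‖ /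
      ‖(l.factorial : ℝ) ^ p * (E ^ l / l.factorial)‖ = ((l + 1 : ℕ) : ℝ) ^ (-(1 - p)) * E := by
    intro l
    have hl : (0 : ℝ) < (l + 1 : ℕ) := Nat.cast_pos.2 l.succ_pos
    have hf : (0 : ℝ) < l.factorial := Nat.cast_pos.2 l.factorial_pos
    rw [Real.norm_of_nonneg (by positivity), Real.norm_of_nonneg (by positivity),
      Nat.factorial_succ, Nat.cast_mul, Real.mul_rpow hl.le hf.le, pow_succ, neg_sub,
      Real.rpow_sub_one hl.ne']
    have := (Real.rpow_pos_of_pos hf p).ne'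
    field_simp
  simp only [h1]
  have h2 := (tendsto_rpow_neg_atTop (sub_pos.2 hp)).comp
    (tendsto_natCast_atTop_atTop.comp (Filter.tendsto_add_atTop_nat 1))
  simpa using h2.mul_const E

/-- Uniform bound for sums with factorial (SPOD) weights, in terms of a selection of digits in
each coordinate. -/
theorem sum_spod_weights_le {s n b : ℕ} [NeZero b] {ρ D : ℝ} (hρ : 0 ≤ ρ)
    (T : (Fin n → ZMod b) → Finset (Fin n))
    (hT : ∀ t : ℝ, 0 ≤ t → ∑ κ, ∏ a ∈ T κ, (t * ρ ^ a.1) ≤ Real.exp (D * t))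
    {p : ℝ} (hp : p < 1) (γ : Fin s → ℝ) (hγ : ∀ j, 0 ≤ γ j) {Γ : ℝ}
    (hΓ : D * ∑ j, γ j ≤ Γ) :
    ∑ k : Fin s → Fin n → ZMod b, ((∑ j, (T (k j)).card).factorial : ℝ) ^ p *
        ∏ j, ∏ a ∈ T (k j), (γ j * ρ ^ a.1) ≤
      ∑' l : ℕ, (l.factorial : ℝ) ^ p * (Real.exp Γ ^ l / l.factorial) := by
  have hV : ∀ (z : ℝ) (k : Fin s → Fin n → ZMod b), 0 ≤ z →
      0 ≤ ∏ j, ∏ a ∈ T (k j), (z * γ j * ρ ^ a.1) := fun z k hz =>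
    Finset.prod_nonneg fun j _ => Finset.prod_nonneg fun a _ =>
      mul_nonneg (mul_nonneg hz (hγ j)) (by positivity)
  have hfib : ∀ l : ℕ, ∑ k : Fin s → Fin n → ZMod b with ∑ j, (T (k j)).card = l,
      ∏ j, ∏ a ∈ T (k j), (γ j * ρ ^ a.1) ≤ Real.exp Γ ^ l / l.factorial := by
    intro l
    have hl : (0 : ℝ) < (l : ℝ) ^ l := by
      rcases Nat.eq_zero_or_pos l with rfl | h
      · simp
      · positivity
    have h1 : (l : ℝ) ^ l * ∑ k : Fin s → Fin n → ZMod b with ∑ j, (T (k j)).card = l,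
        ∏ j, ∏ a ∈ T (k j), (γ j * ρ ^ a.1) ≤ Real.exp Γ ^ l := by
      calc _ = ∑ k : Fin s → Fin n → ZMod b with ∑ j, (T (k j)).card = l,
            ∏ j, ∏ a ∈ T (k j), (l * γ j * ρ ^ a.1) := by
            rw [Finset.mul_sum]
            refine Finset.sum_congr rfl fun k hk => ?_
            conv_lhs => enter [1, 2]; rw [← (Finset.mem_filter.1 hk).2]
            simp only [mul_assoc, Finset.prod_mul_distrib, Finset.prod_const,
              Finset.prod_pow_eq_pow_sum]
        _ ≤ ∑ k : Fin s → Fin n → ZMod b, ∏ j, ∏ a ∈ T (k j), (l * γ j * ρ ^ a.1) :=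
            Finset.sum_le_sum_of_subset_of_nonneg (Finset.filter_subset _ _)
              fun k _ _ => hV l k (Nat.cast_nonneg l)
        _ = ∏ j, ∑ κ, ∏ a ∈ T κ, (l * γ j * ρ ^ a.1) := by rw [Fintype.prod_sum]
        _ ≤ ∏ j, Real.exp (D * (l * γ j)) :=
            Finset.prod_le_prod (fun j _ => Finset.sum_nonneg fun κ _ => Finset.prod_nonneg
              fun a _ => mul_nonneg (mul_nonneg (Nat.cast_nonneg l) (hγ j)) (by positivity))
              fun j _ => hT _ (mul_nonneg (Nat.cast_nonneg l) (hγ j))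
        _ = Real.exp (l * (D * ∑ j, γ j)) := by
            rw [← Real.exp_sum, Finset.mul_sum, Finset.mul_sum]
            congr 1
            exact Finset.sum_congr rfl fun j _ => by ring
        _ ≤ _ := by
            rw [← Real.exp_nat_mul]
            gcongr
    calc _ ≤ Real.exp Γ ^ l / (l : ℝ) ^ l := by rwa [le_div_iff₀' hl]
      _ ≤ _ := by
        gcongr
        exact_mod_cast Nat.factorial_le_pow l
  rw [← Finset.sum_fiberwise_of_maps_to (t := Finset.univ.image fun k : Fin s → Fin n → ZMod b =>
    ∑ j, (T (k j)).card) (g := fun k : Fin s → Fin n → ZMod b =>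
    ∑ j, (T (k j)).card) (fun k hk => Finset.mem_image_of_mem
    (fun k : Fin s → Fin n → ZMod b => ∑ j, (T (k j)).card) hk)]
  refine le_trans (Finset.sum_le_sum fun l _ => ?_)
    ((summable_factorial_rpow_mul_pow hp (Real.exp_pos Γ)).sum_le_tsum _ fun l _ => by positivity)
  calc _ = (l.factorial : ℝ) ^ p * ∑ k : Fin s → Fin n → ZMod b with ∑ j, (T (k j)).card = l,
        ∏ j, ∏ a ∈ T (k j), (γ j * ρ ^ a.1) := by
        rw [Finset.mul_sum]
        exact Finset.sum_congr rfl fun k hk => by rw [(Finset.mem_filter.1 hk).2]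
    _ ≤ _ := mul_le_mul_of_nonneg_left (hfib l) (by positivity)

theorem sum_le_rpow_sum_rpow {κ : Type*} (S : Finset κ) {w : κ → ℝ} (hw : ∀ i ∈ S, 0 ≤ w i)
    {p : ℝ} (hp0 : 0 < p) (hp1 : p ≤ 1) :
    ∑ i ∈ S, w i ≤ (∑ i ∈ S, w i ^ p) ^ (1 / p) := by
  have hp : 0 ≤ 1 / p - 1 := sub_nonneg.2 ((one_le_div hp0).2 hp1)
  have split : ∀ x : ℝ, 0 ≤ x → x ^ (1 / p) = x * x ^ (1 / p - 1) := fun x hx => by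
    conv_lhs => rw [← add_sub_cancel 1 (1 / p), Real.rpow_add_of_nonneg hx zero_le_one hp,
      Real.rpow_one]
  have hS : ∀ i ∈ S, 0 ≤ w i ^ p := fun i hi => Real.rpow_nonneg (hw i hi) p
  rw [split _ (Finset.sum_nonneg hS), Finset.sum_mul]
  refine Finset.sum_le_sum fun i hi => ?_
  calc w i = (w i ^ p) ^ (1 / p) := by
        rw [← Real.rpow_mul (hw i hi), mul_one_div_cancel hp0.ne', Real.rpow_one]
    _ = w i ^ p * (w i ^ p) ^ (1 / p - 1) := split _ (hS i hi)
    _ ≤ _ := mul_le_mul_of_nonneg_left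
        (Real.rpow_le_rpow (hS i hi) (Finset.single_le_sum hS hi) hp) (hS i hi)

theorem exists_digits_equiv (b : ℕ) [NeZero b] (n : ℕ) :
    ∃ e : (Fin n → ZMod b) ≃ Fin (b ^ n), ∀ κ : Fin n → ZMod b,
      ∑ a : Fin n, ((κ a).val : ℝ) / (b : ℝ) ^ (a.1 + 1) = ((e κ).1 : ℝ) / ((b ^ n : ℕ) : ℝ) := by
  have hb : (b : ℝ) ≠ 0 := Nat.cast_ne_zero.2 (NeZero.ne b)
  let f : (Fin n → ZMod b) → Fin (b ^ n) := fun κ =>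
    finFunctionFinEquiv fun a => ⟨(κ (Fin.rev a)).val, ZMod.val_lt _⟩
  have hf : Function.Bijective f := by
    refine (Fintype.bijective_iff_injective_and_card f).2 ⟨fun κ κ' h => ?_, by simp [ZMod.card]⟩
    ext a
    have := congrFun (finFunctionFinEquiv.injective h) (Fin.rev a)
    simpa using ZMod.val_injective b (by simpa using this)
  refine ⟨Equiv.ofBijective f hf, fun κ => ?_⟩
  rw [Equiv.ofBijective_apply, finFunctionFinEquiv_apply_val, ← Equiv.sum_comp Fin.revPerm]
  push_cast
  rw [Finset.sum_div]
  refine Finset.sum_congr rfl fun a _ => ?_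
  have h : n = a.1 + ((Fin.rev a).1 + 1) := by
    rw [Fin.val_rev]
    omega
  rw [Fin.revPerm_apply, show (b : ℝ) ^ n = (b : ℝ) ^ a.1 * (b : ℝ) ^ ((Fin.rev a).1 + 1) by
    rw [← pow_add, ← h]]
  field_simp

open scoped Pointwise in
theorem tsum_grid_eq_sum {s K : ℕ} [NeZero K] (F : (Fin s → ℝ) → ℝ) :
    ∑' x : ↑((Set.univ.pi fun _ : Fin s => Set.Ico (0 : ℝ) 1) ∩
        (K : ℝ)⁻¹ • (Submodule.span ℤ (Set.range (Pi.basisFun ℝ (Fin s))) : Set (Fin s → ℝ))),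
      F x = ∑ z : Fin s → Fin K, F fun j => ((z j).1 : ℝ) / (K : ℝ) := by
  have hK : (0 : ℝ) < K := Nat.cast_pos.2 (Nat.pos_of_ne_zero (NeZero.ne K))
  let g : (Fin s → Fin K) → ↑((Set.univ.pi fun _ : Fin s => Set.Ico (0 : ℝ) 1) ∩
      (K : ℝ)⁻¹ • (Submodule.span ℤ (Set.range (Pi.basisFun ℝ (Fin s))) : Set (Fin s → ℝ))) :=
    fun z => ⟨fun j => ((z j).1 : ℝ) / (K : ℝ), by
      refine ⟨fun j _ => ⟨by positivity, ?_⟩, ?_⟩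
      · rw [div_lt_one hK]
        exact_mod_cast (z j).2
      · refine BoxIntegral.unitPartition.mem_smul_span_iff.2 fun j => ⟨(z j).1, ?_⟩
        simp
        field_simp⟩
  have hg : Function.Bijective g := by
    constructor
    · intro z z' h
      ext j
      have := congrFun (congrArg Subtype.val h) j
      simp only [g] at this
      rw [div_left_inj' hK.ne'] at this
      exact_mod_cast this
    · rintro ⟨x, hx1, hx2⟩
      have hx3 := BoxIntegral.unitPartition.mem_smul_span_iff.1 hx2
      choose z hz using hx3
      have hz' : ∀ j, (z j : ℝ) = K * x j := fun j => by simpa using hz j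
      have h0 : ∀ j, 0 ≤ z j := fun j => by
        have : (0 : ℝ) ≤ z j := by
          rw [hz']
          exact mul_nonneg hK.le (hx1 j trivial).1
        exact_mod_cast this
      have h1 : ∀ j, z j < K := fun j => by
        have : (z j : ℝ) < K := by
          rw [hz']
          exact mul_lt_of_lt_one_right hK (hx1 j trivial).2
        exact_mod_cast this
      refine ⟨fun j => ⟨(z j).toNat, by have := h0 j; have := h1 j; omega⟩, ?_⟩
      ext j
      simp only [g]
      have : (((z j).toNat : ℤ) : ℝ) = z j := by rw [Int.toNat_of_nonneg (h0 j)]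
      rw [Int.cast_natCast] at this
      rw [this, hz']
      field_simp
  rw [← (Equiv.ofBijective g hg).tsum_eq, tsum_fintype]
  rfl

theorem sum_digitPoint_eq {b s n : ℕ} [NeZero b] (F : (Fin s → ℝ) → ℝ) :
    ∑ x : Fin s × Fin n → ZMod b, F (digitPoint (fun _ => 1) x) =
      ∑ z : Fin s → Fin (b ^ n), F fun j => ((z j).1 : ℝ) / ((b ^ n : ℕ) : ℝ) := by
  obtain ⟨e, he⟩ := exists_digits_equiv b n
  refine Fintype.sum_equiv ((Equiv.curry _ _ _).trans (Equiv.piCongrRight fun _ => e)) _ _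
    fun x => ?_
  congr 1
  ext j
  simp only [digitPoint, one_mul, he fun a => x (j, a)]
  rfl

open scoped Pointwise in
theorem tendsto_average_digitPoint {b s : ℕ} (hb : 1 < b) [NeZero b] {F : (Fin s → ℝ) → ℝ}
    (hF : Continuous F) :
    Filter.Tendsto (fun n : ℕ =>
      (∑ x : Fin s × Fin n → ZMod b, F (digitPoint (fun _ => 1) x)) / (b : ℝ) ^ (s * n))
      Filter.atTop (nhds (∫ x in Set.univ.pi fun _ : Fin s => Set.Icc (0 : ℝ) 1, F x)) := by
  have hs : Convex ℝ (Set.univ.pi fun _ : Fin s => Set.Ico (0 : ℝ) 1) :=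
    convex_pi fun _ _ => convex_Ico 0 1
  have hint : ∫ x in Set.univ.pi fun _ : Fin s => Set.Icc (0 : ℝ) 1, F x =
      ∫ x in Set.univ.pi fun _ : Fin s => Set.Ico (0 : ℝ) 1, F x := by
    refine setIntegral_congr_set ?_
    rw [Set.pi_univ_Icc]
    exact Measure.univ_pi_Ico_ae_eq_Icc.symm
  rw [hint]
  have h := (tendsto_tsum_div_pow_atTop_integral (Set.univ.pi fun _ : Fin s => Set.Ico (0 : ℝ) 1) F
    hF (Bornology.IsBounded.pi fun _ => Metric.isBounded_Ico 0 1)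
    (MeasurableSet.univ_pi fun _ => measurableSet_Ico)
    (hs.addHaar_frontier volume)).comp (tendsto_pow_atTop_atTop_of_one_lt hb)
  refine h.congr fun n => ?_
  have : NeZero (b ^ n) := ⟨pow_ne_zero n (NeZero.ne b)⟩
  simp only [Function.comp]
  rw [tsum_grid_eq_sum, sum_digitPoint_eq]
  simp [← pow_mul, mul_comm s n]

theorem norm_walshSum_le_spod {b s n A : ℕ} [NeZero b] {Fd : (Fin s → ℕ) → (Fin s → ℝ) → ℝ}
    (hder : ∀ (ν : Fin s → ℕ) (j : Fin s), (∀ i, ν i ≤ A) → ν j < A → ∀ x : Fin s → ℝ,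
      HasLineDerivAt ℝ (Fd ν) (Fd (ν + Pi.single j 1) x) x (Pi.single j 1))
    {c : ℝ} {β : Fin s → ℝ}
    (hbd : ∀ ν : Fin s → ℕ, (∀ i, ν i ≤ A) → ∀ x : Fin s → ℝ,
      (∀ i, x i ∈ Set.Icc (0 : ℝ) 1) →
        |Fd ν x| ≤ c * ((∑ i, ν i).factorial : ℝ) * ∏ i : Fin s, β i ^ ν i)
    (k : Fin s × Fin n → ZMod b) (T : Fin s → Finset (Fin n))
    (hT : ∀ j, ∀ a ∈ T j, k (j, a) ≠ 0) (hTc : ∀ j, (T j).card ≤ A) :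
    ‖walshSum (fun x => ((Fd 0 (digitPoint (fun _ => 1) x) : ℝ) : ℂ)) k‖ ≤
      (b : ℝ) ^ (s * n) * (c * (((∑ j, (T j).card).factorial : ℝ) *
        ∏ j, ∏ a ∈ T j, (β j * ((b : ℝ) ^ a.1)⁻¹))) := by
  let T' : Finset (Fin s × Fin n) := Finset.univ.filter fun i => i.2 ∈ T i.1
  have hT' : ∀ i : Fin s × Fin n, i ∈ T' ↔ i.1 ∈ Finset.univ ∧ i.2 ∈ T i.1 := by simp [T']
  have hν : (∑ i ∈ T', Pi.single i.1 1 : Fin s → ℕ) = fun j => (T j).card := by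
    ext j
    rw [Finset.sum_finset_product T' Finset.univ T hT', Finset.sum_apply]
    simp [Pi.single_apply]
  have h := norm_walshSum_le hder k (B := c * ((∑ j, (T j).card).factorial : ℝ) *
    ∏ j, β j ^ (T j).card) T' 0 (fun _ => 1) (fun _ => 1)
    (fun i hi => hT i.1 i.2 ((hT' i).1 hi).2) (by rw [hν, zero_add]; exact hTc)
    (by rw [hν, zero_add]; exact hbd _ hTc) (by simp) (by simp) (by simp)
  simp only [mul_one] at h
  refine h.trans (le_of_eq ?_)
  rw [Finset.prod_finset_product T' Finset.univ T hT']
  simp only [Finset.prod_mul_distrib, Finset.prod_const]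
  ring

/-- A digital net with `b ^ m` points whose error, relative to the average over the full grid of
all points with `n` digits per coordinate, is controlled by the SPOD weights. -/
theorem exists_net_error_le_grid {b s m n A : ℕ} [Fact b.Prime] {p : ℝ} (hp0 : 0 < p) (hp1 : p < 1)
    {β : Fin s → ℝ} (hβ : ∀ j, 0 ≤ β j) {D Γ : ℝ} (hΓ : D * ∑ j, β j ^ p ≤ Γ)
    (T : (Fin n → ZMod b) → Finset (Fin n)) (hT : ∀ κ, ∀ a ∈ T κ, κ a ≠ 0)
    (hTc : ∀ κ, (T κ).card ≤ A)
    (hTs : ∀ t : ℝ, 0 ≤ t →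
      ∑ κ, ∏ a ∈ T κ, (t * ((b : ℝ) ^ (-p)) ^ a.1) ≤ Real.exp (D * t)) :
    ∃ y : Fin (b ^ m) → Fin s → ℝ, (∀ i j, y i j ∈ Set.Icc (0 : ℝ) 1) ∧
      ∀ (c : ℝ), 0 < c → ∀ (Fd : (Fin s → ℕ) → (Fin s → ℝ) → ℝ),
        (∀ (ν : Fin s → ℕ) (j : Fin s), (∀ i, ν i ≤ A) → ν j < A → ∀ x : Fin s → ℝ,
          HasLineDerivAt ℝ (Fd ν) (Fd (ν + Pi.single j 1) x) x (Pi.single j 1)) →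
        (∀ ν : Fin s → ℕ, (∀ i, ν i ≤ A) → ∀ x : Fin s → ℝ,
          (∀ i, x i ∈ Set.Icc (0 : ℝ) 1) →
            |Fd ν x| ≤ c * ((∑ i, ν i).factorial : ℝ) * ∏ i : Fin s, β i ^ ν i) →
        |(1 / (b ^ m : ℝ)) * ∑ i, Fd 0 (y i) -
            (∑ x : Fin s × Fin n → ZMod b, Fd 0 (digitPoint (fun _ => 1) x)) /
              (b : ℝ) ^ (s * n)| ≤
          c * (∑' l : ℕ, (l.factorial : ℝ) ^ p * (Real.exp Γ ^ l / l.factorial)) ^ (1 / p) *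
            ((b : ℝ) ^ m) ^ (-(1 / p)) := by
  have hb : (0 : ℝ) < b := Nat.cast_pos.2 (Fact.out : b.Prime).pos
  have hρ : 0 ≤ (b : ℝ) ^ (-p) := by positivity
  set S := ∑' l : ℕ, (l.factorial : ℝ) ^ p * (Real.exp Γ ^ l / l.factorial) with hS
  have hS0 : 0 ≤ S := tsum_nonneg fun l => by positivity
  let w : (Fin s × Fin n → ZMod b) → ℝ := fun k =>
    ((∑ j, (T fun a => k (j, a)).card).factorial : ℝ) *
      ∏ j, ∏ a ∈ T fun a => k (j, a), (β j * ((b : ℝ) ^ a.1)⁻¹)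
  have hw : ∀ k, 0 ≤ w k := fun k => mul_nonneg (Nat.cast_nonneg _) <|
    Finset.prod_nonneg fun j _ => Finset.prod_nonneg fun a _ => mul_nonneg (hβ j) (by positivity)
  have hwp : ∀ k, w k ^ p = ((∑ j, (T fun a => k (j, a)).card).factorial : ℝ) ^ p *
      ∏ j, ∏ a ∈ T fun a => k (j, a), (β j ^ p * ((b : ℝ) ^ (-p)) ^ a.1) := fun k => by
    have h0 : ∀ j, ∀ a : Fin n, 0 ≤ β j * ((b : ℝ) ^ a.1)⁻¹ := fun j a =>
      mul_nonneg (hβ j) (by positivity)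
    simp only [w]
    rw [Real.mul_rpow (Nat.cast_nonneg _)
      (Finset.prod_nonneg fun j _ => Finset.prod_nonneg fun a _ => h0 j a),
      ← Real.finsetProd_rpow _ _ fun j _ => Finset.prod_nonneg fun a _ => h0 j a]
    congr 1
    refine Finset.prod_congr rfl fun j _ => ?_
    rw [← Real.finsetProd_rpow _ _ fun a _ => h0 j a]
    refine Finset.prod_congr rfl fun a _ => ?_
    rw [Real.mul_rpow (hβ j) (by positivity), Real.inv_rpow (by positivity),
      Real.rpow_neg hb.le, inv_pow, ← Real.rpow_natCast, ← Real.rpow_natCast,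
      ← Real.rpow_mul hb.le, ← Real.rpow_mul hb.le, mul_comm p]
  obtain ⟨M, hM⟩ := exists_matrix_dual_sum_le m (fun k => w k ^ p)
    fun k => Real.rpow_nonneg (hw k) p
  have hwS : ∑ k, w k ^ p ≤ S := by
    rw [Fintype.sum_equiv (Equiv.curry (Fin s) (Fin n) (ZMod b)) _ (fun k =>
      ((∑ j, (T (k j)).card).factorial : ℝ) ^ p *
        ∏ j, ∏ a ∈ T (k j), (β j ^ p * ((b : ℝ) ^ (-p)) ^ a.1)) hwp]
    exact sum_spod_weights_le hρ T hTs hp1 _ (fun j => Real.rpow_nonneg (hβ j) p) hΓ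
  have hdual : ∑ k with k ≠ 0 ∧ Matrix.vecMul k M = 0, w k ≤
      S ^ (1 / p) * ((b : ℝ) ^ m) ^ (-(1 / p)) := by
    refine (sum_le_rpow_sum_rpow _ (fun k _ => hw k) hp0 hp1.le).trans ?_
    rw [Real.rpow_neg (by positivity), ← div_eq_mul_inv, ← Real.div_rpow hS0 (by positivity)]
    refine Real.rpow_le_rpow (Finset.sum_nonneg fun k _ => Real.rpow_nonneg (hw k) p)
      (hM.trans ?_) (by positivity)
    gcongr
  let e : Fin (b ^ m) ≃ (Fin m → ZMod b) := Fintype.equivOfCardEq (by simp [ZMod.card])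
  refine ⟨fun i => digitPoint (fun _ => 1) (M.mulVec (e i)),
    fun i j => digitPoint_mem (by simp) _ j, fun c hc Fd hder hbd => ?_⟩
  have herr := digitalNet_error
    (fun x => ((Fd 0 (digitPoint (fun _ => 1) x) : ℝ) : ℂ)) M
  have hnorm := (norm_sum_le
    (Finset.univ.filter fun k : Fin s × Fin n → ZMod b => k ≠ 0 ∧ Matrix.vecMul k M = 0)
    _).trans (Finset.sum_le_sum fun k _ => norm_walshSum_le_spod hder
      hbd k (fun j => T fun a => k (j, a)) (fun j a ha => hT _ a ha) fun j => hTc _)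
  rw [← herr, ← Finset.mul_sum, ← Finset.mul_sum] at hnorm
  rw [Equiv.sum_comp e fun v => Fd 0 (digitPoint (fun _ => 1) (M.mulVec v))]
  have hG : (0 : ℝ) < (b : ℝ) ^ (s * n) := by positivity
  have hcard : Fintype.card (Fin s × Fin n) = s * n := by simp
  set P := ∑ v : Fin m → ZMod b, Fd 0 (digitPoint (fun _ => 1) (M.mulVec v)) with hP
  set Q := ∑ x : Fin s × Fin n → ZMod b, Fd 0 (digitPoint (fun _ => 1) x) with hQ
  have hcast : (b : ℂ) ^ Fintype.card (Fin s × Fin n) *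
      ((∑ v : Fin m → ZMod b, ((Fd 0 (digitPoint (fun _ => 1) (M.mulVec v)) : ℝ) : ℂ)) /
        (b : ℂ) ^ m) - ∑ x : Fin s × Fin n → ZMod b,
          ((Fd 0 (digitPoint (fun _ => 1) x) : ℝ) : ℂ) =
      (((b : ℝ) ^ (s * n) * (1 / (b : ℝ) ^ m * P - Q / (b : ℝ) ^ (s * n)) : ℝ) : ℂ) := by
    rw [mul_sub, mul_div_cancel₀ _ hG.ne', hcard, hP, hQ]
    push_cast
    ring
  rw [hcast, Complex.norm_real, Real.norm_eq_abs, abs_mul, abs_of_pos hG] at hnorm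
  rw [mul_assoc]
  exact (le_of_mul_le_mul_left hnorm hG).trans (mul_le_mul_of_nonneg_left hdual hc.le)

/-- **Main result (Theorem 3.1), case `0 < p < 1`.**
Let `0 < p < 1`, let `(β_j)` be nonnegative with `∑ β_j^p < ∞`, let `b` be
prime and `α := ⌊1/p⌋ + 1`.  Then there is a constant `C` (depending only on
`α`, `β`, `b`, `p`) such that for all `s, m ≥ 1` with `N = b^m` there are QMC
points `y₀, …, y_{N-1} ∈ [0,1]^s` with the property: for every `c > 0` and
every `F : [0,1]^s → ℝ` with continuous mixed partial derivatives of order up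
to `α` in each variable (witnessed by the family `Fd ν = ∂^ν F`, where
consecutive partial derivatives are line derivatives along the coordinate
directions) satisfying `|∂^ν F(y)| ≤ c·|ν|!·∏ β_j^{ν_j}` on the cube for all
`ν ∈ {0,…,α}^s`, the QMC quadrature error satisfies
`|N⁻¹ ∑_n F(y_n) − ∫_{[0,1]^s} F| ≤ c·C·N^{-1/p}`. -/
theorem higher_order_qmc_error_SPOD (p : ℝ) (hp0 : 0 < p) (hp1 : p < 1)
    (β : ℕ → ℝ) (hβ : ∀ j, 0 ≤ β j) (hβsum : Summable fun j => β j ^ p)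
    (b : ℕ) (hb : Nat.Prime b) :
    ∃ C : ℝ, 0 < C ∧
      ∀ s m : ℕ, 1 ≤ s → 1 ≤ m →
        ∃ y : Fin (b ^ m) → Fin s → ℝ,
          (∀ n i, y n i ∈ Set.Icc (0 : ℝ) 1) ∧
          ∀ (c : ℝ), 0 < c →
          ∀ (F : (Fin s → ℝ) → ℝ) (Fd : (Fin s → ℕ) → (Fin s → ℝ) → ℝ),
            Fd 0 = F →
            (∀ ν : Fin s → ℕ, (∀ i, ν i ≤ ⌊1 / p⌋₊ + 1) → Continuous (Fd ν)) →
            (∀ (ν : Fin s → ℕ) (j : Fin s), (∀ i, ν i ≤ ⌊1 / p⌋₊ + 1) →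
              ν j < ⌊1 / p⌋₊ + 1 → ∀ x : Fin s → ℝ,
                HasLineDerivAt ℝ (Fd ν) (Fd (ν + Pi.single j 1) x) x
                  (Pi.single j 1)) →
            (∀ ν : Fin s → ℕ, (∀ i, ν i ≤ ⌊1 / p⌋₊ + 1) →
              ∀ x : Fin s → ℝ, (∀ i, x i ∈ Set.Icc (0 : ℝ) 1) →
                |Fd ν x| ≤
                  c * ((∑ i, ν i).factorial : ℝ) * ∏ i : Fin s, β i.1 ^ ν i) →
            |(1 / (b ^ m : ℝ)) * ∑ n, F (y n) -
                ∫ x in Set.univ.pi fun _ : Fin s => Set.Icc (0 : ℝ) 1, F x| ≤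
              c * C * ((b : ℝ) ^ m) ^ (-(1 / p)) := by
  have : Fact b.Prime := ⟨hb⟩
  have hb0 : (0 : ℝ) < b := Nat.cast_pos.2 hb.pos
  have hb1 : (1 : ℝ) < b := Nat.one_lt_cast.2 hb.one_lt
  set A := ⌊1 / p⌋₊ + 1 with hA
  have hA0 : (0 : ℝ) < A := by positivity
  have hAp : 1 / p < A := by rw [hA]; exact_mod_cast Nat.lt_floor_add_one (1 / p)
  set σ := (b : ℝ) ^ (1 / (A : ℝ)) with hσ
  have hσ1 : 1 ≤ σ := Real.one_le_rpow hb1.le (by positivity)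
  have hσA : σ ^ A = b := by
    rw [hσ, ← Real.rpow_natCast, ← Real.rpow_mul hb0.le, one_div_mul_cancel hA0.ne', Real.rpow_one]
  set ρ := (b : ℝ) ^ (-p) with hρ
  have hρ0 : 0 ≤ ρ := by positivity
  have hθ1 : σ * ρ < 1 := by
    rw [hσ, hρ, ← Real.rpow_add hb0]
    exact Real.rpow_lt_one_of_one_lt_of_neg hb1 (by linarith [(one_div_lt hp0 hA0).1 hAp])
  set D := b * (1 - σ * ρ)⁻¹ with hD
  have hD0 : 0 ≤ D := mul_nonneg hb0.le (inv_nonneg.2 (sub_nonneg.2 hθ1.le))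
  set Γ := D * ∑' j, β j ^ p with hΓ
  set S := ∑' l : ℕ, (l.factorial : ℝ) ^ p * (Real.exp Γ ^ l / l.factorial) with hS
  have hS0 : 0 < S := (summable_factorial_rpow_mul_pow hp1 (Real.exp_pos Γ)).tsum_pos
    (fun l => by positivity) 0 (by simp)
  refine ⟨S ^ (1 / p), by positivity, fun s m _ _ => ?_⟩
  have hΓs : D * ∑ j : Fin s, β j ^ p ≤ Γ := by
    refine mul_le_mul_of_nonneg_left ?_ hD0
    rw [Fin.sum_univ_eq_sum_range fun j => β j ^ p]
    exact hβsum.sum_le_tsum _ fun j _ => Real.rpow_nonneg (hβ j) p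
  choose T hT hTc hTs using fun n => exists_digit_selection hσ1 hσA hρ0 n A le_rfl
  have hTexp : ∀ n : ℕ, ∀ t : ℝ, 0 ≤ t →
      ∑ κ, ∏ a ∈ T n κ, (t * ρ ^ a.1) ≤ Real.exp (D * t) := fun n t ht => by
    refine (hTs n t ht).trans ?_
    rw [Nat.sub_self, pow_zero, one_pow, one_mul, hD, mul_comm _ t, ← mul_assoc]
    exact prod_one_add_geometric_le (by positivity) hθ1 (by positivity) n
  choose y hy herr using fun n => exists_net_error_le_grid (m := m) (A := A) hp0 hp1
    (fun j : Fin s => hβ j) hΓs (T n) (hT n) (hTc n) (hTexp n)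
  obtain ⟨z, hz, φ, hφ, hlim⟩ := (isCompact_univ_pi fun _ : Fin (b ^ m) =>
    isCompact_univ_pi fun _ : Fin s => isCompact_Icc (a := (0 : ℝ)) (b := 1)).tendsto_subseq
      fun n i _ j _ => hy n i j
  refine ⟨z, fun i j => hz i trivial j trivial, ?_⟩
  rintro c hc F Fd rfl hcont hder hbd
  have hF : Continuous (Fd 0) := hcont 0 fun _ => Nat.zero_le _
  refine le_of_tendsto (Filter.Tendsto.abs (Filter.Tendsto.sub (Filter.Tendsto.const_mul _ ?_)
    ((tendsto_average_digitPoint hb.one_lt hF).comp hφ.tendsto_atTop)))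
    (Filter.Eventually.of_forall fun n => herr (φ n) c hc Fd hder hbd)
  exact tendsto_finsetSum _ fun i _ => (hF.tendsto _).comp (tendsto_pi_nhds.1 hlim i)
end
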